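/- arXiv:2601.12565 — 2 statements merged into one kernel-verified Lean document; each statement's English description precedes it below -/
import Mathlib

section
/- Let p be a prime, R a commutative ring in which p is nilpotent, N ⊆ R an ideal all of whose elements are nilpotent (N ⊆ nilradical(R)), and R → R' a faithfully flat ring homomorphism. For an R-algebra S, let Ŵ_N(S) ⊆ W(S) denote the additive subgroup of Witt vectors all of whose coefficients lie in the ideal N·S and all but finitely many of whose coefficients are zero. Then the augmented Čech complex Ŵ_N(R) → Ŵ_N(R') → Ŵ_N(R' ⊗_R R') → ⋯ is acyclic (exact at every term). -/
/-!
STATEMENT 6: Let p be a prime, R a commutative ring in which p is nilpotent,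
N ⊆ nilradical(R) an ideal, and R → R' a faithfully flat ring homomorphism.  For an
R-algebra S let Ŵ_N(S) ⊆ W(S) be the Witt vectors all of whose coefficients lie in
N·S and all but finitely many of whose coefficients are zero.  Then the augmented
Čech complex Ŵ_N(R) → Ŵ_N(R') → Ŵ_N(R' ⊗_R R') → ⋯ is acyclic.
-/

open TensorProduct

universe u

/-- A bundled commutative `R`-algebra. -/
structure CommAlgebraBundle (R : Type u) [CommRing R] : Type (u + 1) where
  carrier : Type u
  [commRing : CommRing carrier]
  [algebra : Algebra R carrier]

attribute [instance] CommAlgebraBundle.commRing CommAlgebraBundle.algebra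

variable {R : Type u} [CommRing R]

/-- `cechAlg R' n` is the `(n+1)`-fold tensor power `R' ⊗_R ⋯ ⊗_R R'`. -/
noncomputable def cechAlg (R' : Type u) [CommRing R'] [Algebra R R'] : ℕ → CommAlgebraBundle R
  | 0 => CommAlgebraBundle.mk R'
  | n + 1 => CommAlgebraBundle.mk ((cechAlg R' n).carrier ⊗[R] R')

/-- The `R`-algebra map inserting `1` into the `i`-th tensor position. -/
noncomputable def cechIns (R' : Type u) [CommRing R'] [Algebra R R'] :
    (n : ℕ) → Fin (n + 2) →
      ((cechAlg (R := R) R' n).carrier →ₐ[R] (cechAlg (R := R) R' (n + 1)).carrier)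
  | 0, i =>
      Fin.cases Algebra.TensorProduct.includeRight
        (fun _ => Algebra.TensorProduct.includeLeft) i
  | n + 1, i =>
      Fin.lastCases Algebra.TensorProduct.includeLeft
        (fun j => Algebra.TensorProduct.map (cechIns R' n j) (AlgHom.id R R')) i

/-- The Čech differential, the alternating sum of the maps induced by inserting `1`
into the possible tensor positions. -/
noncomputable def cechWittD (p : ℕ) [Fact p.Prime] (R' : Type u) [CommRing R'] [Algebra R R']
    (n : ℕ) :
    WittVector p (cechAlg (R := R) R' n).carrier →+
      WittVector p (cechAlg (R := R) R' (n + 1)).carrier :=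
  ∑ i : Fin (n + 2),
    (-1 : ℤ) ^ (i : ℕ) •
      (WittVector.map (p := p) ((cechIns (R := R) R' n i) : _ →+* _)).toAddMonoidHom

/-- Membership in `Ŵ_N(S)`: the coefficients lie in the ideal `N·S` and all but
finitely many of them are zero. -/
def IsHatWIdeal (p : ℕ) [Fact p.Prime] (N : Ideal R) {S : Type u} [CommRing S] [Algebra R S]
    (x : WittVector p S) : Prop :=
  (∀ n, x.coeff n ∈ N.map (algebraMap R S)) ∧ ∃ M, ∀ n ≥ M, x.coeff n = 0

theorem teich_mul_aux {p : ℕ} [Fact p.Prime] {S : Type*} [CommRing S]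
    (hinj : Function.Injective (WittVector.ghostMap : WittVector p S → ℕ → S))
    (t : S) (x : WittVector p S) :
    WittVector.teichmuller p t * x = WittVector.mk p (fun n => t ^ p ^ n * x.coeff n) := by
  apply hinj
  rw [map_mul]
  funext n
  rw [Pi.mul_apply, WittVector.ghostMap_apply, WittVector.ghostMap_apply,
    WittVector.ghostMap_apply, WittVector.ghostComponent_teichmuller,
    WittVector.ghostComponent_apply, WittVector.ghostComponent_apply,
    wittPolynomial_eq_sum_C_mul_X_pow]
  simp only [map_sum, map_mul, map_pow, MvPolynomial.aeval_X, MvPolynomial.aeval_C,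
    Finset.mul_sum, WittVector.coeff_mk]
  refine Finset.sum_congr rfl fun i hi => ?_
  have : p ^ n = p ^ i * p ^ (n - i) := by
    rw [← pow_add]; congr 1; have := Finset.mem_range.1 hi; omega
  rw [mul_pow, ← pow_mul, ← this]
  ring

theorem teich_mul {p : ℕ} [Fact p.Prime] {S : Type*} [CommRing S]
    (t : S) (x : WittVector p S) :
    WittVector.teichmuller p t * x = WittVector.mk p (fun n => t ^ p ^ n * x.coeff n) := by
  have hQ : Function.Injective
      (WittVector.ghostMap : WittVector p (MvPolynomial S ℚ) → ℕ → MvPolynomial S ℚ) := by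
    have : Invertible (p : MvPolynomial S ℚ) :=
      (invertibleOfNonzero (Nat.cast_ne_zero.2 (Fact.out : p.Prime).ne_zero :
        (p : ℚ) ≠ 0)).map (algebraMap ℚ (MvPolynomial S ℚ)) |>.copy _ (by simp)
    exact (WittVector.ghostMap.bijective_of_invertible p _).1
  have hZ : ∀ (t : MvPolynomial S ℤ) (x : WittVector p (MvPolynomial S ℤ)),
      WittVector.teichmuller p t * x = WittVector.mk p (fun n => t ^ p ^ n * x.coeff n) := by
    intro t x
    apply WittVector.map_injective (MvPolynomial.map (Int.castRingHom ℚ))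
      (MvPolynomial.map_injective _ Int.cast_injective)
    rw [map_mul, WittVector.map_teichmuller, teich_mul_aux hQ]
    ext n
    simp [WittVector.map_coeff]
  have hs : Function.Surjective (MvPolynomial.eval₂Hom (Int.castRingHom S) (id : S → S)) :=
    fun s => ⟨MvPolynomial.X s, by simp⟩
  obtain ⟨t, rfl⟩ := hs t
  obtain ⟨x, rfl⟩ := WittVector.map_surjective (p := p) _ hs x
  rw [← WittVector.map_teichmuller, ← map_mul, hZ]
  ext n
  simp [WittVector.map_coeff]

/-- ceiling filtration subring -/
def reesSub {S : Type*} [CommRing S] (J : Ideal S) (q : ℕ) (hq : 0 < q) : Subring (Polynomial S) where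
  carrier := {f | ∀ d k, k * q < d + q → f.coeff d ∈ J ^ k}
  zero_mem' := by intro d k _; simp
  one_mem' := by
    intro d k h
    rw [Polynomial.coeff_one]
    split_ifs with hd
    · subst hd
      have : k = 0 := by
        rcases k with _ | k
        · rfl
        · exfalso; nlinarith
      subst this; simp
    · simp
  add_mem' := by
    intro f g hf hg d k h
    rw [Polynomial.coeff_add]
    exact add_mem (hf d k h) (hg d k h)
  neg_mem' := by
    intro f hf d k h
    rw [Polynomial.coeff_neg]
    exact neg_mem (hf d k h)
  mul_mem' := by
    intro f g hf hg d k h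
    rw [Polynomial.coeff_mul]
    refine sum_mem fun ab hab => ?_
    have hab := Finset.HasAntidiagonal.mem_antidiagonal.1 hab
    have key : ∀ a : ℕ, ∃ c, c * q < a + q ∧ a ≤ c * q := by
      intro a
      refine ⟨(a + q - 1) / q, ?_, ?_⟩
      · have := Nat.div_mul_le_self (a + q - 1) q
        omega
      · have := Nat.lt_div_mul_add hq (a := a + q - 1)
        omega
    obtain ⟨c, hc, hc'⟩ := key ab.1
    obtain ⟨e, he, he'⟩ := key ab.2
    have hk : k ≤ c + e := by
      by_contra hcon
      have : (c + e + 1) * q ≤ k * q := Nat.mul_le_mul_right q (by omega)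
      have h2 : (c + e + 1) * q = c * q + e * q + q := by ring
      omega
    refine Ideal.pow_le_pow_right hk ?_
    rw [pow_add]
    exact Ideal.mul_mem_mul (hf _ _ hc) (hg _ _ he)

theorem ppos (p : ℕ) [Fact p.Prime] (M : ℕ) : 0 < p ^ M := pow_pos (Fact.out : p.Prime).pos M

theorem coeff_bound {p : ℕ} [Fact p.Prime] {S : Type*} [CommRing S] (J : Ideal S) (M : ℕ)
    (x : WittVector p S) (hx : ∀ n, x.coeff n ∈ J) (hM : ∀ n ≥ M, x.coeff n = 0) :
    ∃ x' : WittVector p (reesSub J (p ^ M) (ppos p M)), WittVector.map (reesSub J (p ^ M) (ppos p M)).subtype x' =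
      WittVector.teichmuller p Polynomial.X * WittVector.map Polynomial.C x := by
  refine ⟨WittVector.mk p fun n => ⟨Polynomial.X ^ p ^ n * Polynomial.C (x.coeff n), ?_⟩, ?_⟩
  · intro d k h
    rw [mul_comm, Polynomial.coeff_C_mul_X_pow]
    split_ifs with hd
    · by_cases hn : n < M
      · have h1 : p ^ n ≤ p ^ M := Nat.pow_le_pow_right (Fact.out : p.Prime).pos hn.le
        have hk : k ≤ 1 := by
          by_contra hcon
          have := Nat.mul_le_mul_right (p ^ M) (show 2 ≤ k by omega)
          omega
        exact Ideal.pow_le_pow_right hk (by simpa using hx n)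
      · rw [hM n (by omega)]; simp
    · simp
  · rw [teich_mul]
    ext1 n
    simp [WittVector.map_coeff]

theorem coeff_bound' {p : ℕ} [Fact p.Prime] {S : Type*} [CommRing S] (J : Ideal S) (K M : ℕ)
    (hJ : J ^ K = ⊥) (x : WittVector p S)
    (h : ∃ x' : WittVector p (reesSub J (p ^ M) (ppos p M)), WittVector.map (reesSub J (p ^ M) (ppos p M)).subtype x' =
      WittVector.teichmuller p Polynomial.X * WittVector.map Polynomial.C x) :
    ∀ n ≥ M + K, x.coeff n = 0 := by
  obtain ⟨x', hx'⟩ := h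
  intro n hn
  have h1 := (x'.coeff n).2 (p ^ n) K ?_
  · have h2 := congrArg (fun z => (WittVector.coeff z n).coeff (p ^ n)) hx'
    simp only [teich_mul, WittVector.map_coeff, WittVector.coeff_mk] at h2
    rw [mul_comm, Polynomial.coeff_C_mul_X_pow, if_pos rfl] at h2
    rw [← h2]
    rw [hJ] at h1
    simpa using h1
  · have h1 : p ^ (M + K) ≤ p ^ n := Nat.pow_le_pow_right (Fact.out : p.Prime).pos hn
    have h2 : K < p ^ K := Nat.lt_pow_self (Fact.out : p.Prime).one_lt
    have h3 := Nat.mul_le_mul_right (p ^ M) h2.le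
    have h4 := ppos p M
    rw [pow_add, mul_comm] at h1
    omega

theorem fin_add {p : ℕ} [Fact p.Prime] {S : Type*} [CommRing S] (J : Ideal S) (K : ℕ)
    (hJ : J ^ K = ⊥) (x y : WittVector p S)
    (hx : ∀ n, x.coeff n ∈ J) (hM : ∃ M, ∀ n ≥ M, x.coeff n = 0)
    (hy : ∀ n, y.coeff n ∈ J) (hM' : ∃ M, ∀ n ≥ M, y.coeff n = 0) :
    ∃ M, ∀ n ≥ M, (x + y).coeff n = 0 := by
  obtain ⟨M1, hM1⟩ := hM
  obtain ⟨M2, hM2⟩ := hM'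
  obtain ⟨x', hx'⟩ := coeff_bound J (max M1 M2) x hx
    (fun n hn => hM1 n (le_trans (le_max_left _ _) hn))
  obtain ⟨y', hy'⟩ := coeff_bound J (max M1 M2) y hy
    (fun n hn => hM2 n (le_trans (le_max_right _ _) hn))
  exact ⟨_, coeff_bound' J K (max M1 M2) hJ (x + y)
    ⟨x' + y', by rw [map_add, hx', hy', map_add, mul_add]⟩⟩

theorem fin_neg {p : ℕ} [Fact p.Prime] {S : Type*} [CommRing S] (J : Ideal S) (K : ℕ)
    (hJ : J ^ K = ⊥) (x : WittVector p S)
    (hx : ∀ n, x.coeff n ∈ J) (hM : ∃ M, ∀ n ≥ M, x.coeff n = 0) :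
    ∃ M, ∀ n ≥ M, (-x).coeff n = 0 := by
  obtain ⟨M1, hM1⟩ := hM
  obtain ⟨x', hx'⟩ := coeff_bound J M1 x hx hM1
  exact ⟨_, coeff_bound' J K M1 hJ (-x)
    ⟨-x', by rw [map_neg, hx', map_neg, mul_neg]⟩⟩

/-- Witt vectors with coefficients in an ideal. -/
noncomputable def wIdeal (p : ℕ) [Fact p.Prime] {S : Type*} [CommRing S] (J : Ideal S) :
    AddSubgroup (WittVector p S) :=
  (WittVector.map (p := p) (Ideal.Quotient.mk J)).toAddMonoidHom.ker

theorem mem_wIdeal {p : ℕ} [Fact p.Prime] {S : Type*} [CommRing S] {J : Ideal S}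
    {x : WittVector p S} : x ∈ wIdeal p J ↔ ∀ n, x.coeff n ∈ J := by
  unfold wIdeal
  rw [AddMonoidHom.mem_ker]
  change WittVector.map (Ideal.Quotient.mk J) x = 0 ↔ _
  rw [WittVector.map_eq_zero_iff]
  simp only [Ideal.Quotient.eq_zero_iff_mem]

/-- Finitely supported Witt vectors with coefficients in a nilpotent ideal. -/
noncomputable def hatW (p : ℕ) [Fact p.Prime] {S : Type*} [CommRing S] (J : Ideal S) (hJ : IsNilpotent J) :
    AddSubgroup (WittVector p S) where
  carrier := {x | x ∈ wIdeal p J ∧ ∃ M, ∀ n ≥ M, x.coeff n = 0}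
  zero_mem' := ⟨zero_mem _, 0, by simp⟩
  add_mem' := by
    rintro x y ⟨hx, hx'⟩ ⟨hy, hy'⟩
    obtain ⟨K, hK⟩ := hJ
    exact ⟨add_mem hx hy, fin_add J K hK x y (mem_wIdeal.1 hx) hx' (mem_wIdeal.1 hy) hy'⟩
  neg_mem' := by
    rintro x ⟨hx, hx'⟩
    obtain ⟨K, hK⟩ := hJ
    exact ⟨neg_mem hx, fin_neg J K hK x (mem_wIdeal.1 hx) hx'⟩

theorem wittAdd_linear (p : ℕ) [Fact p.Prime] (n : ℕ) :
    WittVector.wittAdd p n - MvPolynomial.X (0, n) - MvPolynomial.X (1, n) ∈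
      MvPolynomial.idealOfVars (Fin 2 × ℕ) ℤ ^ 2 := by
  have hvar : ∀ f : MvPolynomial (Fin 2 × ℕ) ℤ, MvPolynomial.constantCoeff f = 0 →
      f ∈ MvPolynomial.idealOfVars (Fin 2 × ℕ) ℤ := by
    intro f hf
    rw [← pow_one (MvPolynomial.idealOfVars (Fin 2 × ℕ) ℤ), MvPolynomial.mem_pow_idealOfVars_iff']
    intro x hx
    have : x = 0 := by
      have : x.degree = 0 := by omega
      exact (Finsupp.degree_eq_zero_iff x).1 this
    subst this
    rw [← hf, MvPolynomial.constantCoeff_eq]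
  have hghost : ∀ g : ℕ → MvPolynomial (Fin 2 × ℕ) ℤ, (∀ i, MvPolynomial.constantCoeff (g i) = 0) →
      MvPolynomial.bind₁ g (wittPolynomial p ℤ n) - (p ^ n : ℤ) • g n ∈
        MvPolynomial.idealOfVars (Fin 2 × ℕ) ℤ ^ 2 := by
    intro g hg
    rw [wittPolynomial_eq_sum_C_mul_X_pow, map_sum, Finset.sum_range_succ]
    simp only [map_mul, map_pow, MvPolynomial.bind₁_X_right, MvPolynomial.bind₁_C_right]
    rw [add_sub_assoc]
    refine add_mem (sum_mem fun i hi => ?_) ?_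
    · refine Ideal.mul_mem_left _ _ ?_
      have h2 : 2 ≤ p ^ (n - i) := by
        have := Finset.mem_range.1 hi
        calc 2 ≤ p := (Fact.out : p.Prime).two_le
          _ = p ^ 1 := (pow_one p).symm
          _ ≤ _ := Nat.pow_le_pow_right (Fact.out : p.Prime).pos (by omega)
      exact Ideal.pow_le_pow_right h2 (Ideal.pow_mem_pow (hvar _ (hg i)) _)
    · simp [zsmul_eq_mul]
  have h0 := hghost (WittVector.wittAdd p) (WittVector.constantCoeff_wittAdd p)
  have h1 := hghost (fun i => MvPolynomial.X (0, i)) (by simp)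
  have h2 := hghost (fun i => MvPolynomial.X (1, i)) (by simp)
  have h3 := wittStructureInt_prop p (MvPolynomial.X 0 + MvPolynomial.X 1 : MvPolynomial (Fin 2) ℤ) n
  have h4 : (p ^ n : ℤ) • (WittVector.wittAdd p n - MvPolynomial.X (0, n) - MvPolynomial.X (1, n)) ∈
      MvPolynomial.idealOfVars (Fin 2 × ℕ) ℤ ^ 2 := by
    have h5 := sub_mem (add_mem h1 h2) h0
    rw [WittVector.wittAdd, h3] at h5
    have e1 : ∀ j : Fin 2, MvPolynomial.bind₁ (fun i => MvPolynomial.X (j, i))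
        (wittPolynomial p ℤ n) = MvPolynomial.rename (Prod.mk j) (wittPolynomial p ℤ n) :=
      fun _ => DFunLike.congr_fun (MvPolynomial.algHom_ext (by simp)) _
    rw [map_add, MvPolynomial.bind₁_X_right, MvPolynomial.bind₁_X_right, e1, e1] at h5
    convert h5 using 1
    rw [smul_sub, smul_sub, WittVector.wittAdd]
    abel
  rw [MvPolynomial.mem_pow_idealOfVars_iff'] at h4 ⊢
  intro x hx
  have h5 := h4 x hx
  rw [MvPolynomial.coeff_smul, smul_eq_mul] at h5
  refine (mul_eq_zero.1 h5).resolve_left ?_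
  exact pow_ne_zero _ (Int.natCast_ne_zero.2 (Fact.out : p.Prime).ne_zero)

theorem add_coeff_mod {p : ℕ} [Fact p.Prime] {S : Type*} [CommRing S] (J : Ideal S)
    (x y : WittVector p S) (hx : x ∈ wIdeal p J) (hy : y ∈ wIdeal p J) (n : ℕ) :
    (x + y).coeff n - x.coeff n - y.coeff n ∈ J ^ 2 := by
  have h := wittAdd_linear p n
  let φ := MvPolynomial.aeval (R := ℤ) (Function.uncurry ![x.coeff, y.coeff])
  have hm : (MvPolynomial.idealOfVars (Fin 2 × ℕ) ℤ).map (φ : _ →+* S) ≤ J := by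
    rw [MvPolynomial.idealOfVars, Ideal.map_span, Ideal.span_le]
    rintro _ ⟨_, ⟨⟨i, k⟩, rfl⟩, rfl⟩
    fin_cases i
    · simpa [φ] using mem_wIdeal.1 hx k
    · simpa [φ] using mem_wIdeal.1 hy k
  have h2 := Ideal.mem_map_of_mem (φ : _ →+* S) h
  rw [Ideal.map_pow] at h2
  have h3 := Ideal.pow_right_mono hm 2 h2
  rw [WittVector.add_coeff]
  simpa [φ, WittVector.peval] using h3

/-- The n-th coefficient, as an additive map on Witt vectors of an ideal modulo the square. -/
noncomputable def coeffMod (p : ℕ) [Fact p.Prime] {S : Type*} [CommRing S] (J : Ideal S) (n : ℕ) :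
    wIdeal p J →+ S ⧸ J ^ 2 :=
  AddMonoidHom.mk' (fun x => Ideal.Quotient.mk (J ^ 2) (x.1.coeff n)) (by
    intro x y
    have := add_coeff_mod J x.1 y.1 x.2 y.2 n
    rw [← map_add, Ideal.Quotient.mk_eq_mk_iff_sub_mem]
    rw [← sub_sub]
    exact this)

section abstractPart

variable {A B C : Type u} [CommRing A] [CommRing B] [CommRing C] [Algebra R A] [Algebra R B]
  [Algebra R C]

/-- Alternating sum on Witt vectors. -/
noncomputable def wD (p : ℕ) [Fact p.Prime] {a : ℕ} (f : Fin a → (A →ₐ[R] B)) :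
    WittVector p A →+ WittVector p B :=
  ∑ i : Fin a, (-1 : ℤ) ^ (i : ℕ) •
    (WittVector.map (p := p) ((f i) : A →+* B)).toAddMonoidHom

/-- Alternating sum, linear version. -/
noncomputable def lD {a : ℕ} (f : Fin a → (A →ₐ[R] B)) : A →ₗ[R] B :=
  ∑ i : Fin a, (-1 : ℤ) ^ (i : ℕ) • (f i).toLinearMap

theorem wD_apply (p : ℕ) [Fact p.Prime] {a : ℕ} (f : Fin a → (A →ₐ[R] B)) (x : WittVector p A) :
    wD p f x = ∑ i : Fin a, (-1 : ℤ) ^ (i : ℕ) • WittVector.map (p := p) ((f i) : A →+* B) x := by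
  unfold wD
  rw [AddMonoidHom.finsetSum_apply]
  rfl

theorem lD_apply {a : ℕ} (f : Fin a → (A →ₐ[R] B)) (x : A) :
    lD f x = ∑ i : Fin a, (-1 : ℤ) ^ (i : ℕ) • f i x := by
  unfold lD
  rw [LinearMap.sum_apply]
  rfl

theorem map_alg_mem (I : Ideal R) (f : A →ₐ[R] B) {x : A} (hx : x ∈ I.map (algebraMap R A)) :
    f x ∈ I.map (algebraMap R B) := by
  have := Ideal.mem_map_of_mem (f : A →+* B) hx
  rw [Ideal.map_map, AlgHom.comp_algebraMap] at this
  exact this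

theorem lD_mem (I : Ideal R) {a : ℕ} (f : Fin a → (A →ₐ[R] B)) {x : A}
    (hx : x ∈ I.map (algebraMap R A)) : lD f x ∈ I.map (algebraMap R B) := by
  rw [lD_apply]
  exact sum_mem fun i _ => zsmul_mem (map_alg_mem I (f i) hx) _

theorem wmap_mem {p : ℕ} [Fact p.Prime] (I : Ideal R) (f : A →ₐ[R] B) {x : WittVector p A}
    (hx : x ∈ wIdeal p (I.map (algebraMap R A))) :
    WittVector.map (f : A →+* B) x ∈ wIdeal p (I.map (algebraMap R B)) := by
  rw [mem_wIdeal] at hx ⊢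
  intro n
  rw [WittVector.map_coeff]
  exact map_alg_mem I f (hx n)

theorem wD_mem {p : ℕ} [Fact p.Prime] (I : Ideal R) {a : ℕ} (f : Fin a → (A →ₐ[R] B))
    {x : WittVector p A} (hx : x ∈ wIdeal p (I.map (algebraMap R A))) :
    wD p f x ∈ wIdeal p (I.map (algebraMap R B)) := by
  rw [wD_apply]
  exact sum_mem fun i _ => zsmul_mem (wmap_mem I (f i) hx) _

theorem wD_coeff {p : ℕ} [Fact p.Prime] (I : Ideal R) {a : ℕ} (f : Fin a → (A →ₐ[R] B))
    {x : WittVector p A} (hx : x ∈ wIdeal p (I.map (algebraMap R A))) (n : ℕ) :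
    (wD p f x).coeff n - lD f (x.coeff n) ∈ (I.map (algebraMap R B)) ^ 2 := by
  rw [← Ideal.Quotient.mk_eq_mk_iff_sub_mem]
  have h1 : (⟨wD p f x, wD_mem I f hx⟩ : wIdeal p (I.map (algebraMap R B))) =
      ∑ i : Fin a, (-1 : ℤ) ^ (i : ℕ) • ⟨WittVector.map (f i : A →+* B) x, wmap_mem I (f i) hx⟩ := by
    apply Subtype.ext
    simp [wD_apply]
  have h2 := congrArg (coeffMod p (I.map (algebraMap R B)) n) h1
  rw [map_sum] at h2
  simp only [map_zsmul] at h2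
  change Ideal.Quotient.mk _ _ = _ at h2
  rw [h2, lD_apply, map_sum]
  refine Finset.sum_congr rfl fun i _ => ?_
  rw [map_zsmul]
  rfl

theorem nilp_map {I : Ideal R} (hI : IsNilpotent I) : IsNilpotent (I.map (algebraMap R A)) := by
  obtain ⟨K, hK⟩ := hI
  refine ⟨K, ?_⟩
  rw [← Ideal.map_pow, hK]
  exact Ideal.map_bot

theorem mem_hatW {p : ℕ} [Fact p.Prime] {I : Ideal R} (hI : IsNilpotent I) {x : WittVector p A} :
    x ∈ hatW p (I.map (algebraMap R A)) (nilp_map hI) ↔ IsHatWIdeal p I x := by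
  unfold IsHatWIdeal
  rw [← mem_wIdeal]
  rfl

theorem isHat_map {p : ℕ} [Fact p.Prime] {I : Ideal R} (f : A →ₐ[R] B) {x : WittVector p A}
    (hx : IsHatWIdeal p I x) : IsHatWIdeal p I (WittVector.map (f : A →+* B) x) := by
  refine ⟨mem_wIdeal.1 (wmap_mem I f (mem_wIdeal.2 hx.1)), ?_⟩
  obtain ⟨M, hM⟩ := hx.2
  exact ⟨M, fun n hn => by rw [WittVector.map_coeff, hM n hn, map_zero]⟩

theorem isHat_wD {p : ℕ} [Fact p.Prime] {I : Ideal R} (hI : IsNilpotent I) {a : ℕ}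
    (f : Fin a → (A →ₐ[R] B)) {x : WittVector p A}
    (hx : IsHatWIdeal p I x) : IsHatWIdeal p I (wD p f x) := by
  rw [← mem_hatW hI, wD_apply]
  exact sum_mem fun i _ => zsmul_mem ((mem_hatW hI).2 (isHat_map (f i) hx)) _

theorem isHat_mono {p : ℕ} [Fact p.Prime] {I I' : Ideal R} (h : I ≤ I') {x : WittVector p A}
    (hx : IsHatWIdeal p I x) : IsHatWIdeal p I' x :=
  ⟨fun n => Ideal.map_mono h (hx.1 n), hx.2⟩

theorem exists_fg_mem (N : Ideal R) {z : A} (hz : z ∈ N.map (algebraMap R A)) :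
    ∃ N₀ : Ideal R, N₀ ≤ N ∧ N₀.FG ∧ z ∈ N₀.map (algebraMap R A) := by
  unfold Ideal.map at hz
  induction hz using Submodule.span_induction with
  | mem x hx =>
    obtain ⟨r, hr, rfl⟩ := hx
    refine ⟨Ideal.span {r}, ?_, ⟨{r}, by simp⟩, ?_⟩
    · rw [Ideal.span_singleton_le_iff_mem]; exact hr
    · exact Ideal.mem_map_of_mem _ (Ideal.mem_span_singleton_self r)
  | zero => exact ⟨⊥, bot_le, Submodule.fg_bot, zero_mem _⟩
  | add x y _ _ hx hy =>
    obtain ⟨I, h1, h2, h3⟩ := hx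
    obtain ⟨J, h1', h2', h3'⟩ := hy
    exact ⟨I ⊔ J, sup_le h1 h1', Submodule.FG.sup h2 h2',
      add_mem (Ideal.map_mono le_sup_left h3) (Ideal.map_mono le_sup_right h3')⟩
  | smul a x _ hx =>
    obtain ⟨I, h1, h2, h3⟩ := hx
    exact ⟨I, h1, h2, Ideal.mul_mem_left _ _ h3⟩

theorem isHat_fg {p : ℕ} [Fact p.Prime] {N : Ideal R} (hN : N ≤ nilradical R) {x : WittVector p A}
    (hx : IsHatWIdeal p N x) :
    ∃ N₀ : Ideal R, N₀ ≤ N ∧ IsNilpotent N₀ ∧ IsHatWIdeal p N₀ x := by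
  obtain ⟨M, hM⟩ := hx.2
  choose F hF1 hF2 hF3 using fun n => exists_fg_mem N (hx.1 n)
  have hle : (⨆ i ∈ Finset.range M, F i) ≤ N := iSup₂_le fun i _ => hF1 i
  have hfg : (⨆ i ∈ Finset.range M, F i).FG := Submodule.fg_biSup _ _ fun i _ => hF2 i
  refine ⟨_, hle, (Ideal.FG.isNilpotent_iff_le_nilradical hfg).2 (hle.trans hN), ?_, hx.2⟩
  intro n
  by_cases hn : n < M
  · have : F n ≤ ⨆ i ∈ Finset.range M, F i :=
      le_iSup₂_of_le n (Finset.mem_range.2 hn) le_rfl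
    exact Ideal.map_mono this (hF3 n)
  · rw [hM n (by omega)]; exact zero_mem _

theorem abs_exact {p : ℕ} [Fact p.Prime] {a b : ℕ} (f : Fin a → (A →ₐ[R] B))
    (g : Fin b → (B →ₐ[R] C)) (hgf : ∀ x, wD p g (wD p f x) = 0)
    (hex : ∀ (I I' : Ideal R), I' ≤ I → ∀ z ∈ I.map (algebraMap R B),
      lD g z ∈ I'.map (algebraMap R C) → ∃ y ∈ I.map (algebraMap R A),
        z - lD f y ∈ I'.map (algebraMap R B))
    (N : Ideal R) (hN : N ≤ nilradical R) (x : WittVector p B) (hx : IsHatWIdeal p N x)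
    (hd : wD p g x = 0) : ∃ y, IsHatWIdeal p N y ∧ wD p f y = x := by
  obtain ⟨N₀, hle, ⟨K, hK⟩, hx₀⟩ := isHat_fg hN hx
  suffices H : ∀ j k : ℕ, 1 ≤ k → k + j = K + 1 → ∀ x : WittVector p B,
      IsHatWIdeal p (N₀ ^ k) x → wD p g x = 0 →
      ∃ y, IsHatWIdeal p (N₀ ^ k) y ∧ wD p f y = x by
    obtain ⟨y, hy, hyx⟩ := H K 1 le_rfl (by omega) x (by simpa using hx₀) hd
    exact ⟨y, isHat_mono (by simpa using hle) hy, hyx⟩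
  intro j
  induction j with
  | zero =>
    intro k hk hkj x hx _
    have hb : N₀ ^ k = ⊥ := by
      obtain rfl : k = K + 1 := by omega
      rw [pow_succ, hK]; simp
    refine ⟨0, ⟨fun n => by simp, 0, by simp⟩, ?_⟩
    rw [map_zero]
    ext n
    have := hx.1 n
    rw [hb, Ideal.map_bot] at this
    simpa using this.symm
  | succ j ih =>
    intro k hk hkj x hx hdx
    have hnil : IsNilpotent (N₀ ^ k) := by
      refine ⟨K, ?_⟩
      rw [← pow_mul, mul_comm, pow_mul, hK]
      exact zero_pow (by omega)
    have hle2 : N₀ ^ (k + 1) ≤ N₀ ^ k := Ideal.pow_le_pow_right (by omega)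
    have hsq : ∀ (S : Type u) [CommRing S] [Algebra R S],
        ((N₀ ^ k).map (algebraMap R S)) ^ 2 ≤ (N₀ ^ (k + 1)).map (algebraMap R S) := by
      intro S _ _
      rw [← Ideal.map_pow, ← pow_mul]
      exact Ideal.map_mono (Ideal.pow_le_pow_right (by omega))
    have hcoef : ∀ n, ∃ y ∈ (N₀ ^ k).map (algebraMap R A),
        x.coeff n - lD f y ∈ (N₀ ^ (k + 1)).map (algebraMap R B) ∧ (x.coeff n = 0 → y = 0) := by
      intro n
      by_cases h0 : x.coeff n = 0
      · exact ⟨0, zero_mem _, by rw [h0]; simp, fun _ => rfl⟩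
      · have h1 := wD_coeff (N₀ ^ k) g (mem_wIdeal.2 hx.1) n
        rw [hdx, WittVector.zero_coeff, zero_sub] at h1
        obtain ⟨y, hy, hy'⟩ := hex (N₀ ^ k) (N₀ ^ (k + 1)) hle2 _ (hx.1 n)
          (by simpa using hsq C h1)
        exact ⟨y, hy, hy', fun h => absurd h h0⟩
    choose y hy1 hy2 hy3 using hcoef
    have hyhat : IsHatWIdeal p (N₀ ^ k) (WittVector.mk p y) := by
      refine ⟨hy1, ?_⟩
      obtain ⟨M, hM⟩ := hx.2
      exact ⟨M, fun n hn => hy3 n (hM n hn)⟩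
    have hdy := isHat_wD hnil f hyhat
    have hsub : IsHatWIdeal p (N₀ ^ k) (x - wD p f (WittVector.mk p y)) := by
      rw [← mem_hatW hnil] at hx hdy ⊢
      exact sub_mem hx hdy
    have hsub' : IsHatWIdeal p (N₀ ^ (k + 1)) (x - wD p f (WittVector.mk p y)) := by
      refine ⟨fun n => ?_, hsub.2⟩
      have h1 := hsq B (add_coeff_mod _ _ _ (mem_wIdeal.2 hsub.1) (mem_wIdeal.2 hdy.1) n)
      rw [sub_add_cancel] at h1
      have h2 := hsq B (wD_coeff (N₀ ^ k) f (mem_wIdeal.2 hyhat.1) n)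
      have h3 := hy2 n
      have h4 := sub_mem (sub_mem h3 h2) h1
      convert h4 using 1
      simp only [WittVector.coeff_mk]
      ring
    obtain ⟨y', hy', hyy⟩ := ih (k + 1) (by omega) (by omega) _ hsub'
      (by rw [map_sub, hdx, hgf, sub_zero])
    refine ⟨WittVector.mk p y + y', ?_, by rw [map_add, hyy]; abel⟩
    have hy'' := isHat_mono hle2 hy'
    rw [← mem_hatW hnil] at hyhat hy'' ⊢
    exact add_mem hyhat hy''

end abstractPart

section concretePart

theorem descent_mem (R' : Type u) [CommRing R'] [Algebra R R'] [Module.FaithfullyFlat R R']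
    {B : Type u} [AddCommGroup B] [Module R B] (Q : Submodule R B) (b : B)
    (hb : b ⊗ₜ[R] (1 : R') ∈ LinearMap.range (LinearMap.rTensor R' Q.subtype)) : b ∈ Q := by
  obtain ⟨t, ht⟩ := hb
  have h1 : LinearMap.rTensor R' Q.mkQ (b ⊗ₜ[R] (1 : R')) = 0 := by
    rw [← ht, ← LinearMap.comp_apply, ← LinearMap.rTensor_comp]
    have : Q.mkQ ∘ₗ Q.subtype = 0 := by ext x; simp
    rw [this]; simp
  rw [LinearMap.rTensor_tmul] at h1
  have h2 := congrArg (TensorProduct.comm R _ _) h1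
  rw [TensorProduct.comm_tmul, map_zero, Module.FaithfullyFlat.one_tmul_eq_zero_iff] at h2
  simpa using h2

theorem rTensor_mem_range (R' : Type u) [CommRing R'] [Algebra R R']
    {A B : Type u} [AddCommGroup A] [Module R A] [AddCommGroup B] [Module R B]
    (I : Ideal R) (φ : A →ₗ[R] B) (Q : Submodule R B) (h : ∀ r ∈ I, ∀ a : A, φ (r • a) ∈ Q)
    (z : A ⊗[R] R') (hz : z ∈ I • (⊤ : Submodule R (A ⊗[R] R'))) :
    LinearMap.rTensor R' φ z ∈ LinearMap.range (LinearMap.rTensor R' Q.subtype) := by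
  induction hz using Submodule.smul_induction_on' with
  | smul r hr t _ =>
    induction t using TensorProduct.induction_on with
    | zero => simp
    | tmul a s =>
      refine ⟨(⟨φ (r • a), h r hr a⟩ : Q) ⊗ₜ s, ?_⟩
      simp [TensorProduct.smul_tmul']
    | add x y hx hy =>
      rw [smul_add, map_add]
      exact add_mem (hx trivial) (hy trivial)
  | add x _ y _ hx hy =>
    rw [map_add]; exact add_mem hx hy

variable (R' : Type u) [CommRing R'] [Algebra R R']

theorem mem_smul_top {A : Type u} [CommRing A] [Algebra R A] (I : Ideal R) (z : A) :
    z ∈ I • (⊤ : Submodule R A) ↔ z ∈ I.map (algebraMap R A) := by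
  rw [Ideal.smul_top_eq_map]; rfl

theorem smul_mem_map {A : Type u} [CommRing A] [Algebra R A] (I : Ideal R) {r : R} (hr : r ∈ I)
    (a : A) : r • a ∈ I.map (algebraMap R A) :=
  (mem_smul_top I _).1 (Submodule.smul_mem_smul hr trivial)

/-- The step of the descent argument. -/
theorem descent_step [Module.FaithfullyFlat R R'] {A B : Type u} [CommRing A] [Algebra R A]
    [CommRing B] [Algebra R B] (φ : A →ₗ[R] B) (I I' : Ideal R) (z : B) (w : A ⊗[R] R')
    (hw : w ∈ I.map (algebraMap R (A ⊗[R] R')))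
    (e : ℤ) (he : e * e = 1)
    (h : LinearMap.rTensor R' φ w + e • (z ⊗ₜ[R] (1 : R')) ∈ I'.map (algebraMap R (B ⊗[R] R'))) :
    ∃ y ∈ I.map (algebraMap R A), z - φ y ∈ I'.map (algebraMap R B) := by
  let Q : Submodule R B := ((I.map (algebraMap R A)).restrictScalars R).map φ ⊔
    (I'.map (algebraMap R B)).restrictScalars R
  have h1 : LinearMap.rTensor R' φ w ∈ LinearMap.range (LinearMap.rTensor R' Q.subtype) := by
    refine rTensor_mem_range R' I φ Q (fun r hr a => ?_) w ((mem_smul_top I w).2 hw)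
    exact Submodule.mem_sup_left ⟨_, smul_mem_map I hr a, rfl⟩
  have h2 := rTensor_mem_range R' I' LinearMap.id Q (fun r hr a => Submodule.mem_sup_right
    (smul_mem_map I' hr a)) _ ((mem_smul_top I' _).2 h)
  rw [LinearMap.rTensor_id, LinearMap.id_apply] at h2
  have h3 := zsmul_mem (sub_mem h2 h1) e
  rw [add_sub_cancel_left, smul_smul, he, one_smul] at h3
  have h4 := descent_mem R' Q z h3
  obtain ⟨_, ⟨y, hy, rfl⟩, v, hv, hyv⟩ := Submodule.mem_sup.1 h4
  refine ⟨y, hy, ?_⟩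
  rw [← hyv, add_sub_cancel_left]
  exact hv

theorem cechIns_castSucc (m : ℕ) (j : Fin (m + 2)) :
    cechIns (R := R) R' (m + 1) j.castSucc =
      Algebra.TensorProduct.map (cechIns (R := R) R' m j) (AlgHom.id R R') := by
  rw [cechIns]
  exact Fin.lastCases_castSucc ..

theorem cechIns_last (m : ℕ) :
    cechIns (R := R) R' m (Fin.last (m + 1)) =
      (Algebra.TensorProduct.includeLeft :
        (cechAlg (R := R) R' m).carrier →ₐ[R] (cechAlg (R := R) R' m).carrier ⊗[R] R') := by
  cases m with
  | zero => rfl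
  | succ m =>
    rw [cechIns]
    exact Fin.lastCases_last ..

theorem cechIns_zero_zero :
    cechIns (R := R) R' 0 0 =
      (Algebra.TensorProduct.includeRight : R' →ₐ[R] R' ⊗[R] R') := rfl

theorem rTensor_lD {A B : Type u} [CommRing A] [Algebra R A] [CommRing B] [Algebra R B] {a : ℕ}
    (f : Fin a → (A →ₐ[R] B)) (z : A ⊗[R] R') :
    LinearMap.rTensor R' (lD f) z =
      ∑ i : Fin a, (-1 : ℤ) ^ (i : ℕ) • Algebra.TensorProduct.map (f i) (AlgHom.id R R') z := by
  induction z using TensorProduct.induction_on with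
  | zero => simp
  | tmul x y =>
    rw [LinearMap.rTensor_tmul, lD_apply, TensorProduct.sum_tmul]
    refine Finset.sum_congr rfl fun i _ => ?_
    rw [Algebra.TensorProduct.map_tmul, AlgHom.id_apply, TensorProduct.smul_tmul']
  | add x y hx hy =>
    simp only [map_add, smul_add, Finset.sum_add_distrib, hx, hy]

theorem lD_succ_gen {A : Type u} [CommRing A] [Algebra R A] {a : ℕ}
    (f : Fin a → (A →ₐ[R] A ⊗[R] R'))
    (g : Fin (a + 1) → (A ⊗[R] R' →ₐ[R] (A ⊗[R] R') ⊗[R] R'))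
    (h1 : ∀ j, g j.castSucc = Algebra.TensorProduct.map (f j) (AlgHom.id R R'))
    (h2 : g (Fin.last a) = Algebra.TensorProduct.includeLeft) (z : A ⊗[R] R') :
    lD g z = LinearMap.rTensor R' (lD f) z + ((-1 : ℤ) ^ a) • (z ⊗ₜ[R] (1 : R')) := by
  rw [lD_apply, Fin.sum_univ_castSucc, rTensor_lD]
  simp only [h1, h2]
  rfl

theorem lD_zero_gen (f : Fin 1 → (R →ₐ[R] R')) (g : Fin 2 → (R' →ₐ[R] R' ⊗[R] R'))
    (h1 : g 0 = Algebra.TensorProduct.includeRight)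
    (h2 : g 1 = Algebra.TensorProduct.includeLeft) (z : R') :
    lD g z = LinearMap.rTensor R' (lD f) ((1 : R) ⊗ₜ[R] z) + (-1 : ℤ) • (z ⊗ₜ[R] (1 : R')) := by
  rw [lD_apply, Fin.sum_univ_two, LinearMap.rTensor_tmul, lD_apply, Fin.sum_univ_one, h1, h2]
  simp

theorem hex_succ [Module.FaithfullyFlat R R'] (m : ℕ) (I I' : Ideal R) (_ : I' ≤ I)
    (z : (cechAlg (R := R) R' (m + 1)).carrier) (hz : z ∈ I.map (algebraMap R _))
    (hd : lD (cechIns (R := R) R' (m + 1)) z ∈ I'.map (algebraMap R _)) :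
    ∃ y ∈ I.map (algebraMap R _), z - lD (cechIns (R := R) R' m) y ∈ I'.map (algebraMap R _) := by
  have e := lD_succ_gen R' (cechIns (R := R) R' m) (cechIns (R := R) R' (m + 1))
    (cechIns_castSucc R' m) (cechIns_last R' (m + 1)) z
  have hd := Set.mem_of_eq_of_mem e.symm hd
  exact descent_step R' (lD (cechIns (R := R) R' m)) I I' z z hz ((-1) ^ (m + 2))
    (by rw [← mul_pow]; simp) hd

/-- The augmentation as a family. -/
noncomputable def augF : Fin 1 → (R →ₐ[R] (cechAlg (R := R) R' 0).carrier) :=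
  fun _ => Algebra.ofId R _

theorem wD_aug (p : ℕ) [Fact p.Prime] (x : WittVector p R) :
    wD p (augF (R := R) R') x = WittVector.map (algebraMap R R') x := by
  rw [wD_apply]
  simp [augF]
  rfl

theorem hex_zero [Module.FaithfullyFlat R R'] (I I' : Ideal R) (_ : I' ≤ I)
    (z : (cechAlg (R := R) R' 0).carrier) (hz : z ∈ I.map (algebraMap R _))
    (hd : lD (cechIns (R := R) R' 0) z ∈ I'.map (algebraMap R _)) :
    ∃ y ∈ I.map (algebraMap R R), z - lD (augF (R := R) R') y ∈ I'.map (algebraMap R _) := by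
  have hw := map_alg_mem (A := R') I
    (Algebra.TensorProduct.includeRight : R' →ₐ[R] R ⊗[R] R') hz
  refine descent_step R' (lD (augF (R := R) R')) I I' z _ hw (-1) (by simp) ?_
  have gen := fun (f : Fin 1 → (R →ₐ[R] R')) (g : Fin 2 → (R' →ₐ[R] R' ⊗[R] R')) =>
    lD_zero_gen R' f g
  have e := gen (augF (R := R) R') (cechIns (R := R) R' 0) rfl rfl z
  exact Set.mem_of_eq_of_mem e.symm hd

theorem gen1 {A B : Type u} [CommRing A] [Algebra R A] [CommRing B] [Algebra R B]
    (f : A →ₐ[R] B) : (Algebra.TensorProduct.map f (AlgHom.id R R')).comp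
      (Algebra.TensorProduct.includeLeft : A →ₐ[R] A ⊗[R] R') =
      (Algebra.TensorProduct.includeLeft : B →ₐ[R] B ⊗[R] R').comp f := by
  ext x; simp

theorem gen2 {A B C : Type u} [CommRing A] [Algebra R A] [CommRing B] [Algebra R B]
    [CommRing C] [Algebra R C] (f : A →ₐ[R] B) (g : B →ₐ[R] C) :
    (Algebra.TensorProduct.map g (AlgHom.id R R')).comp
      (Algebra.TensorProduct.map f (AlgHom.id R R')) =
      Algebra.TensorProduct.map (g.comp f) (AlgHom.id R R') := by
  ext x <;> simp

theorem gen3 {A B : Type u} [CommRing A] [Algebra R A] [CommRing B] [Algebra R B]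
    (f : A →ₐ[R] B) : (Algebra.TensorProduct.map f (AlgHom.id R R')).comp
      (Algebra.TensorProduct.includeRight : R' →ₐ[R] A ⊗[R] R') =
      (Algebra.TensorProduct.includeRight : R' →ₐ[R] B ⊗[R] R') := by
  ext x; simp

theorem gen4 {A B C : Type u} [CommRing A] [Algebra R A] [CommRing B] [Algebra R B]
    [CommRing C] [Algebra R C] (f : A →ₐ[R] B) (g : B →ₐ[R] C) (f' : A →ₐ[R] B) (g' : B →ₐ[R] C)
    (h : g.comp f = g'.comp f') :
    (Algebra.TensorProduct.map g (AlgHom.id R R')).comp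
      (Algebra.TensorProduct.map f (AlgHom.id R R')) =
    (Algebra.TensorProduct.map g' (AlgHom.id R R')).comp
      (Algebra.TensorProduct.map f' (AlgHom.id R R')) := by
  rw [gen2, gen2, h]

theorem cechIns_comp (m : ℕ) (i j : Fin (m + 2)) (hij : i ≤ j) :
    (cechIns (R := R) R' (m + 1) j.succ).comp (cechIns R' m i) =
      (cechIns (R := R) R' (m + 1) i.castSucc).comp (cechIns R' m j) := by
  induction m with
  | zero =>
    induction j using Fin.lastCases with
    | last =>
      rw [Fin.succ_last, cechIns_last, cechIns_last, cechIns_castSucc]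
      exact (gen1 R' _).symm
    | cast j =>
      obtain rfl : j = 0 := Subsingleton.elim _ _
      obtain rfl : i = 0 := by simpa using hij
      have e1 : (Fin.succ (Fin.castSucc (0 : Fin 1))) = Fin.castSucc (1 : Fin 2) := rfl
      have e2 : (Fin.castSucc (0 : Fin 1)) = (0 : Fin 2) := rfl
      rw [e1, e2, cechIns_castSucc, cechIns_castSucc]
      exact (gen3 R' _).trans (gen3 R' _).symm
  | succ m ih =>
    induction j using Fin.lastCases with
    | last =>
      rw [Fin.succ_last, cechIns_last, cechIns_last, cechIns_castSucc]
      exact (gen1 R' _).symm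
    | cast j =>
      induction i using Fin.lastCases with
      | last => exact absurd hij (by simp [Fin.le_def])
      | cast i =>
        rw [Fin.succ_castSucc]
        have h := gen4 R' (cechIns R' m i) (cechIns R' (m + 1) j.succ) (cechIns R' m j)
          (cechIns R' (m + 1) i.castSucc) (ih i j (Fin.castSucc_le_castSucc_iff.1 hij))
        exact (congrArg₂ AlgHom.comp (cechIns_castSucc R' (m + 1) j.succ)
          (cechIns_castSucc R' m i)).trans (h.trans (congrArg₂ AlgHom.comp
            (cechIns_castSucc R' (m + 1) i.castSucc) (cechIns_castSucc R' m j)).symm)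

theorem sum_alt {G : Type*} [AddCommGroup G] (n : ℕ) (F : Fin (n + 2) → Fin (n + 3) → G)
    (hF : ∀ i j : Fin (n + 2), i ≤ j → F i j.succ = F j i.castSucc) :
    ∑ i : Fin (n + 2), ∑ j : Fin (n + 3), ((-1 : ℤ) ^ (i : ℕ) * (-1) ^ (j : ℕ)) • F i j = 0 := by
  simp only [← Finset.sum_product']
  let P := Fin (n + 2) × Fin (n + 3)
  let S : Finset P := {ij : P | (ij.2 : ℕ) ≤ (ij.1 : ℕ)}
  rw [Finset.univ_product_univ, ← Finset.sum_add_sum_compl S, ← eq_neg_iff_add_eq_zero,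
    ← Finset.sum_neg_distrib]
  let φ : ∀ ij : P, ij ∈ S → P := fun ij hij =>
    (Fin.castLT ij.2 (lt_of_le_of_lt (Finset.mem_filter.mp hij).right (Fin.is_lt ij.1)), ij.1.succ)
  apply Finset.sum_bij φ
  · intro ij hij
    simp_rw [S, φ, Finset.compl_filter, Finset.mem_filter_univ, Fin.val_succ,
      Fin.val_castLT] at hij ⊢
    lia
  · rintro ⟨i, j⟩ hij ⟨i', j'⟩ hij' h
    rw [Prod.mk_inj]
    exact ⟨by simpa [φ] using! congr_arg Prod.snd h,
      by simpa [φ, Fin.castSucc_castLT] using! congr_arg Fin.castSucc (congr_arg Prod.fst h)⟩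
  · rintro ⟨i', j'⟩ hij'
    simp_rw [S, Finset.compl_filter, Finset.mem_filter_univ, not_le] at hij'
    refine ⟨(j'.pred <| ?_, Fin.castSucc i'), ?_, ?_⟩
    · rintro rfl
      simp only [Fin.val_zero, not_lt_zero] at hij'
    · simpa [S] using! Nat.le_sub_one_of_lt hij'
    · simp only [φ, Fin.castLT_castSucc, Fin.succ_pred]
  · rintro ⟨i, j⟩ hij
    dsimp only [φ]
    rw [hF _ _ (by simpa [S, Fin.le_def] using hij), Fin.castSucc_castLT, ← neg_smul]
    congr 1
    simp only [Fin.val_succ, Fin.val_castLT, pow_succ]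
    ring

theorem cech_sq (p : ℕ) [Fact p.Prime] (m : ℕ) (x : WittVector p (cechAlg (R := R) R' m).carrier) :
    wD p (cechIns (R := R) R' (m + 1)) (wD p (cechIns (R := R) R' m) x) = 0 := by
  simp only [wD_apply, map_sum, map_zsmul, Finset.smul_sum, smul_smul]
  refine sum_alt m (fun i j => WittVector.map (cechIns (R := R) R' (m + 1) j).toRingHom
    (WittVector.map (cechIns (R := R) R' m i).toRingHom x)) ?_
  intro i j hij
  ext n
  rw [WittVector.map_coeff, WittVector.map_coeff, WittVector.map_coeff, WittVector.map_coeff]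
  exact DFunLike.congr_fun (cechIns_comp R' m i j hij) (x.coeff n)

theorem cech_sq0 (p : ℕ) [Fact p.Prime] (x : WittVector p R) :
    wD p (cechIns (R := R) R' 0) (wD p (augF (R := R) R') x) = 0 := by
  rw [wD_apply _ (cechIns (R := R) R' 0), Fin.sum_univ_two]
  have : ∀ i, WittVector.map (cechIns (R := R) R' 0 i).toRingHom
      (wD p (augF (R := R) R') x) = WittVector.map (algebraMap R _) x := by
    intro i
    have e := wD_aug (R := R) R' p x
    ext n
    rw [WittVector.map_coeff, WittVector.map_coeff, congrArg (fun y => WittVector.coeff y n) e]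
    exact (cechIns (R := R) R' 0 i).commutes _
  have h0 := this 0
  have h1 := this 1
  rw [AlgHom.toRingHom_eq_coe] at h0 h1
  rw [h0, h1]
  simp

end concretePart

theorem hatWIdeal_cech_acyclic (p : ℕ) [Fact p.Prime]
    (R R' : Type u) [CommRing R] [CommRing R'] [Algebra R R']
    (hp : IsNilpotent (p : R)) (N : Ideal R) (hN : N ≤ nilradical R)
    [Module.FaithfullyFlat R R'] :
    -- the maps of the complex preserve the subgroups `Ŵ_N(-)`
    (∀ x : WittVector p R, IsHatWIdeal p N x →
        IsHatWIdeal p N (WittVector.map (algebraMap R R') x)) ∧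
    (∀ (m : ℕ) (x : WittVector p (cechAlg (R := R) R' m).carrier), IsHatWIdeal p N x →
        IsHatWIdeal p N (cechWittD p R' m x)) ∧
    -- exactness at the augmentation term
    (∀ x : WittVector p R, IsHatWIdeal p N x →
        WittVector.map (algebraMap R R') x = 0 → x = 0) ∧
    -- exactness at the degree 0 term
    (∀ x : WittVector p (cechAlg (R := R) R' 0).carrier, IsHatWIdeal p N x →
        (cechWittD p R' 0 x = 0 ↔
          ∃ y : WittVector p R, IsHatWIdeal p N y ∧
            WittVector.map (algebraMap R R') y = x)) ∧
    -- exactness at the higher terms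
    (∀ (m : ℕ) (x : WittVector p (cechAlg (R := R) R' (m + 1)).carrier),
        IsHatWIdeal p N x →
        (cechWittD p R' (m + 1) x = 0 ↔
          ∃ y, IsHatWIdeal p N y ∧ cechWittD p R' m y = x)) := by
  have haug : ∀ (x : WittVector p R), IsHatWIdeal p N x →
        IsHatWIdeal p N (WittVector.map (algebraMap R R') x) := fun x hx =>
    isHat_map (Algebra.ofId R R') hx
  refine ⟨haug, ?_, ?_, ?_, ?_⟩
  · intro m x hx
    obtain ⟨N₀, hle, hnil, hx₀⟩ := isHat_fg hN hx
    exact isHat_mono hle (isHat_wD hnil (cechIns (R := R) R' m) hx₀)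
  · intro x _ h
    refine WittVector.map_injective (algebraMap R R') ?_ (h.trans (map_zero _).symm)
    exact FaithfulSMul.algebraMap_injective R R'
  · intro x hx
    constructor
    · intro h
      obtain ⟨y, hy, hyx⟩ := abs_exact (augF (R := R) R') (cechIns (R := R) R' 0)
        (cech_sq0 R' p) (hex_zero R') N hN x hx h
      exact ⟨y, hy, by rw [← hyx, wD_aug]⟩
    · rintro ⟨y, hy, rfl⟩
      have := cech_sq0 R' p y
      rw [wD_aug] at this
      exact this
  · intro m x hx
    constructor
    · intro h
      exact abs_exact (cechIns (R := R) R' m) (cechIns (R := R) R' (m + 1))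
        (cech_sq R' p m) (hex_succ R' m) N hN x hx h
    · rintro ⟨y, hy, rfl⟩
      exact cech_sq R' p m y
end

section
/- Let p be a prime, n ≥ 1, R a semiperfect 𝔽_p-algebra, and R → R' a faithfully flat ind-étale ring homomorphism. For a commutative ring S, let Ŵ(S)[Fⁿ] denote the intersection of Ŵ(S) with the kernel of the n-th iterate of the Witt vector Frobenius on W(S). Then the augmented Čech complex Ŵ(R)[Fⁿ] → Ŵ(R')[Fⁿ] → Ŵ(R' ⊗_R R')[Fⁿ] → ⋯ is acyclic (exact at every term). -/
/-!
STATEMENT 8: Let p be a prime, n ≥ 1, R a semiperfect 𝔽_p-algebra, and R → R' a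
faithfully flat ind-étale ring homomorphism.  Then the augmented Čech complex
Ŵ(R)[Fⁿ] → Ŵ(R')[Fⁿ] → Ŵ(R' ⊗_R R')[Fⁿ] → ⋯ is acyclic (exact at every term).
-/

open TensorProduct

universe u

/-- A presentation of `R'` as a filtered colimit of étale `R`-algebras. -/
structure IndEtalePresentation (R : Type u) [CommRing R]
    (R' : Type u) [CommRing R'] [Algebra R R'] : Type (u + 1) where
  ι : Type u
  [pre : Preorder ι]
  directed : IsDirected ι (· ≤ ·)
  nonempty : Nonempty ι
  A : ι → CommAlgebraBundle R
  trans : ∀ i j : ι, i ≤ j → ((A i).carrier →ₐ[R] (A j).carrier)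
  toColim : ∀ i : ι, (A i).carrier →ₐ[R] R'
  etale : ∀ i : ι, Algebra.Etale R (A i).carrier
  trans_id : ∀ i : ι, trans i i le_rfl = AlgHom.id R (A i).carrier
  trans_comp : ∀ (i j k : ι) (hij : i ≤ j) (hjk : j ≤ k),
    (trans j k hjk).comp (trans i j hij) = trans i k (hij.trans hjk)
  toColim_comp : ∀ (i j : ι) (hij : i ≤ j), (toColim j).comp (trans i j hij) = toColim i
  jointly_surjective : ∀ x : R', ∃ (i : ι) (y : (A i).carrier), toColim i y = x
  eventually_zero : ∀ (i : ι) (y : (A i).carrier), toColim i y = 0 →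
    ∃ (j : ι) (hij : i ≤ j), trans i j hij y = 0

/-- A ring homomorphism is ind-étale if its target is a filtered colimit of étale
algebras over its source. -/
def IsIndEtale (R : Type u) [CommRing R] (R' : Type u) [CommRing R'] [Algebra R R'] : Prop :=
  Nonempty (IndEtalePresentation R R')

/-- Membership in `Ŵ(S)[Fⁿ]`: the coefficients are nilpotent, all but finitely many
of them are zero, and the n-th iterate of the Witt vector Frobenius kills `x`. -/
def IsHatWKerF (p : ℕ) [Fact p.Prime] (n : ℕ) {S : Type u} [CommRing S]
    (x : WittVector p S) : Prop :=
  (∀ m, IsNilpotent (x.coeff m)) ∧ (∃ N, ∀ m ≥ N, x.coeff m = 0) ∧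
    (⇑(WittVector.frobenius (p := p) (R := S)))^[n] x = 0

variable {R : Type u} [CommRing R]

/-! ### Part 1: étale algebras over semiperfect rings -/

lemma hw_charP (p : ℕ) [hp : Fact p.Prime] {S : Type*} [CommRing S] [Nontrivial S]
    (h : (p : S) = 0) : CharP S p :=
  (CharP.charP_iff_prime_eq_zero hp.out).2 h

lemma hw_surj_of_unram (p n : ℕ) [hp : Fact p.Prime] {A B : Type*} [CommRing A] [CommRing B]
    [Algebra A B] [Algebra.FormallyUnramified A B] [Algebra.FiniteType A B]
    (h0 : (p : B) = 0)
    (h : ∀ b : B, ∃ a : A, algebraMap A B a = b ^ p ^ n) :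
    Function.Surjective (algebraMap A B) := by
  rcases subsingleton_or_nontrivial B with hB | hB
  · exact fun b => ⟨0, Subsingleton.elim _ _⟩
  have hnt : Nontrivial (B ⊗[A] B) := (Algebra.TensorProduct.lmul' A (S := B)).toRingHom.domain_nontrivial
  have h0' : (p : B ⊗[A] B) = 0 := by
    have := congrArg (Algebra.TensorProduct.includeLeft : B →ₐ[A] B ⊗[A] B) h0
    simpa using this
  have := hw_charP p h0'
  have := hw_charP p h0
  have hq : p ^ n ≠ 0 := pow_ne_zero _ hp.out.ne_zero
  have key : ∀ x : B ⊗[A] B,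
      x ^ p ^ n = ((1 : B) ⊗ₜ[A] (Algebra.TensorProduct.lmul' A (S := B) x)) ^ p ^ n := by
    intro x
    induction x with
    | zero => simp
    | add x y hx hy => rw [add_pow_char_pow, hx, hy, map_add, TensorProduct.tmul_add, add_pow_char_pow]
    | tmul x y =>
      obtain ⟨a, ha⟩ := h x
      simp only [Algebra.TensorProduct.tmul_pow, Algebra.TensorProduct.lmul'_apply_tmul, one_pow,
        mul_pow, ← ha]
      rw [Algebra.algebraMap_eq_smul_one, TensorProduct.smul_tmul]
      simp [Algebra.smul_def]
  obtain ⟨t, ht1, ht2⟩ := (Algebra.FormallyUnramified.iff_exists_tensorProduct (R := A) (S := B)).1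
    inferInstance
  have htu : t ^ p ^ n = 1 := by
    rw [key, ht2, ← Algebra.TensorProduct.one_def, one_pow]
  have hepi : Algebra.IsEpi A B := by
    rw [Algebra.isEpi_iff_forall_one_tmul_eq]
    intro s
    have h1 : IsUnit t := IsUnit.of_pow_eq_one htu hq
    have := ht1 s
    rw [h1.mul_left_eq_zero, sub_eq_zero] at this
    exact this
  have hint : Algebra.IsIntegral A B := by
    constructor
    intro b
    obtain ⟨a, ha⟩ := h b
    exact IsIntegral.of_pow (Nat.pos_of_ne_zero hq) (ha ▸ isIntegral_algebraMap)
  have hfin : Module.Finite A B := Algebra.IsIntegral.finite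
  exact Algebra.isEpi_iff_surjective_algebraMap_of_finite.1 hepi

lemma hw_inj_of_etale {T S : Type*} [CommRing T] [CommRing S] [Algebra T S] [Algebra.Etale T S]
    (hs : Function.Surjective (algebraMap T S))
    (hn : RingHom.ker (algebraMap T S) ≤ nilradical T) :
    Function.Injective (algebraMap T S) := by
  have hid := (Algebra.FormallyEtale.iff_of_surjective hs).1 inferInstance
  have hfg : (RingHom.ker (algebraMap T S)).FG :=
    Algebra.FinitePresentation.ker_fG_of_surjective (Algebra.ofId T S) hs
  obtain ⟨k, hk⟩ := hfg.isNilpotent_iff_le_nilradical.2 hn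
  rw [RingHom.injective_iff_ker_eq_bot]
  cases k with
  | zero =>
    rw [pow_zero] at hk
    exact le_bot_iff.1 (le_trans (by rw [Ideal.one_eq_top]; exact le_top) hk.le)
  | succ k => rw [hid.pow_succ_eq] at hk; exact hk

lemma hw_inj_of_etale' {A T S : Type*} [CommRing A] [CommRing T] [CommRing S] [Algebra A T]
    [Algebra A S] [Algebra.Etale A T] [Algebra.Etale A S] (π : T →ₐ[A] S)
    (hs : Function.Surjective π) (hn : ∀ t, π t = 0 → IsNilpotent t) :
    Function.Injective π := by
  let alg : Algebra T S := π.toRingHom.toAlgebra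
  have : IsScalarTower A T S := IsScalarTower.of_algebraMap_eq (fun a => (π.commutes a).symm)
  have : Algebra.Etale T S := .of_restrictScalars A T S
  exact hw_inj_of_etale (T := T) (S := S) hs (fun t ht => hn t ht)

lemma hw_tensor_lift {R S S' Q : Type*} [CommRing R] [CommRing S] [CommRing S'] [CommRing Q]
    [Algebra R S] [Algebra R S'] (σ : S →+* Q) (σ' : S' →+* Q)
    (h : σ.comp (algebraMap R S) = σ'.comp (algebraMap R S')) :
    ∃ τ : S ⊗[R] S' →+* Q, ∀ x y, τ (x ⊗ₜ y) = σ x * σ' y := by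
  let alg : Algebra R Q := (σ.comp (algebraMap R S)).toAlgebra
  refine ⟨(Algebra.TensorProduct.lift
      (⟨σ, fun r => rfl⟩ : S →ₐ[R] Q)
      (⟨σ', fun r => (RingHom.congr_fun h r).symm⟩ : S' →ₐ[R] Q)
      (fun _ _ => mul_comm _ _)).toRingHom, fun x y => ?_⟩
  exact Algebra.TensorProduct.lift_tmul ..

/-- Relative perfectness: Frobenius is surjective and its kernel is generated from the base. -/
def HwRelPerf (p n : ℕ) [Fact p.Prime] (R S : Type*) [CommRing R] [CommRing S] [Algebra R S] :
    Prop :=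
  (∀ s : S, ∃ t : S, t ^ p ^ n = s) ∧
    ∀ s : S, s ^ p ^ n = 0 → s ∈ Ideal.span (algebraMap R S '' {r | r ^ p ^ n = 0})

lemma hw_relPerf_of_etale (p n : ℕ) [hp : Fact p.Prime] (R S : Type u) [CommRing R] [CommRing S]
    [Algebra R S] [Algebra.Etale R S] [CharP R p]
    (hsp : ∀ x : R, ∃ y : R, y ^ p ^ n = x) : HwRelPerf p n R S := by
  rcases subsingleton_or_nontrivial S with hS | hS
  · refine ⟨fun s => ⟨0, Subsingleton.elim _ _⟩, fun s _ => ?_⟩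
    rw [Subsingleton.elim s 0]; exact zero_mem _
  have h0 : (p : S) = 0 := by
    rw [← map_natCast (algebraMap R S), CharP.cast_eq_zero R p, map_zero]
  have := hw_charP p h0
  let φ : R →+* R := iterateFrobenius R p n
  have hφ : Function.Surjective φ := hsp
  let I : Ideal R := RingHom.ker φ
  let e : (R ⧸ I) ≃+* R := RingHom.quotientKerEquivOfSurjective hφ
  let S0 : Subring S := (iterateFrobenius S p n).range
  -- surjectivity
  have hsurj : ∀ s : S, ∃ t : S, t ^ p ^ n = s := by
    have hR : ∀ r : R, algebraMap R S r ∈ S0 := by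
      intro r
      obtain ⟨y, rfl⟩ := hsp r
      exact ⟨algebraMap R S y, by simp [iterateFrobenius_def]⟩
    let : Algebra R S0 := ((algebraMap R S).codRestrict S0 hR).toAlgebra
    have : IsScalarTower R S0 S := IsScalarTower.of_algebraMap_eq (fun r => rfl)
    have : Algebra.FormallyUnramified S0 S := Algebra.FormallyUnramified.of_restrictScalars R S0 S
    have : Algebra.FiniteType S0 S := Algebra.FiniteType.of_restrictScalars_finiteType R S0 S
    have := hw_surj_of_unram p n (A := S0) (B := S) h0 (fun b => ⟨⟨b ^ p ^ n, b, rfl⟩, rfl⟩)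
    intro s
    obtain ⟨⟨_, t, rfl⟩, rfl⟩ := this s
    exact ⟨t, rfl⟩
  refine ⟨hsurj, ?_⟩
  -- injectivity
  let K : Ideal S := I.map (algebraMap R S)
  have hK : K ≤ RingHom.ker (iterateFrobenius S p n) := by
    rw [Ideal.map_le_iff_le_comap]
    intro r hr
    have hr' : r ^ p ^ n = 0 := hr
    simp [RingHom.mem_ker, iterateFrobenius_def, ← map_pow, hr']
  let T := S ⧸ K
  let π : T →+* S := Ideal.Quotient.lift K (iterateFrobenius S p n) hK
  let algS : Algebra (R ⧸ I) S := ((algebraMap R S).comp e.toRingHom).toAlgebra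
  have : Algebra.Etale (R ⧸ I) T :=
    .of_equiv (Algebra.TensorProduct.quotIdealMapEquivQuotTensor S I).symm
  have : Algebra.Etale (R ⧸ I) S := by
    let : Algebra (R ⧸ I) R := e.toRingHom.toAlgebra
    have : IsScalarTower (R ⧸ I) R S := IsScalarTower.of_algebraMap_eq (fun r => rfl)
    have : Algebra.Etale (R ⧸ I) R := .of_equiv (AlgEquiv.ofRingEquiv (f := e) (fun r => rfl))
    exact .comp (R ⧸ I) R S
  have hinj : Function.Injective π := by
    refine hw_inj_of_etale' (A := R ⧸ I) (⟨π, ?_⟩ : T →ₐ[R ⧸ I] S) ?_ ?_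
    · intro r
      obtain ⟨r, rfl⟩ := Ideal.Quotient.mk_surjective r
      change (algebraMap R S r) ^ p ^ n = algebraMap R S (r ^ p ^ n)
      simp
    · intro s
      obtain ⟨t, ht⟩ := hsurj s
      exact ⟨Ideal.Quotient.mk K t, ht⟩
    · intro t ht
      obtain ⟨s, rfl⟩ := Ideal.Quotient.mk_surjective t
      have : s ^ p ^ n = 0 := ht
      exact ⟨p ^ n, by rw [← map_pow, this, map_zero]⟩
  intro s hs
  have : Ideal.Quotient.mk K s = 0 := by
    apply hinj
    rw [map_zero]
    exact hs
  rw [Ideal.Quotient.eq_zero_iff_mem] at this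
  exact this

lemma hw_relPerf_tensor (p n : ℕ) [hp : Fact p.Prime] (R S S' : Type u) [CommRing R] [CommRing S]
    [CommRing S'] [Algebra R S] [Algebra R S'] (h0 : (p : R) = 0)
    (hsp : ∀ x : R, ∃ y : R, y ^ p ^ n = x) (h : HwRelPerf p n R S) (h' : HwRelPerf p n R S') :
    HwRelPerf p n R (S ⊗[R] S') := by
  have hq : p ^ n ≠ 0 := pow_ne_zero _ hp.out.ne_zero
  rcases subsingleton_or_nontrivial (S ⊗[R] S') with hS | hT
  · refine ⟨fun s => ⟨0, Subsingleton.elim _ _⟩, fun s _ => ?_⟩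
    rw [Subsingleton.elim s 0]; exact zero_mem _
  have h0T : ∀ (B : Type u) [CommRing B] [Algebra R B], (p : B) = 0 := by
    intro B _ _
    have := congrArg (algebraMap R B) h0
    simpa using this
  have : Nontrivial S :=
    (Algebra.TensorProduct.includeLeft : S →ₐ[R] S ⊗[R] S').toRingHom.domain_nontrivial
  have : Nontrivial S' :=
    (Algebra.TensorProduct.includeRight : S' →ₐ[R] S ⊗[R] S').toRingHom.domain_nontrivial
  have := hw_charP p (h0T (S ⊗[R] S'))
  have := hw_charP p (h0T S)
  have := hw_charP p (h0T S')
  refine ⟨?_, ?_⟩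
  · intro s
    induction s with
    | zero => exact ⟨0, zero_pow hq⟩
    | add x y hx hy =>
      obtain ⟨x, rfl⟩ := hx
      obtain ⟨y, rfl⟩ := hy
      exact ⟨x + y, add_pow_char_pow ..⟩
    | tmul x y =>
      obtain ⟨x, rfl⟩ := h.1 x
      obtain ⟨y, rfl⟩ := h'.1 y
      exact ⟨x ⊗ₜ y, by simp⟩
  · let K : Ideal (S ⊗[R] S') := Ideal.span (algebraMap R (S ⊗[R] S') '' {r | r ^ p ^ n = 0})
    -- the inverse of Frobenius
    have hσ : ∀ (B : Type u) [CommRing B] [Algebra R B] [CharP B p] (f : B →ₐ[R] S ⊗[R] S')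
        (hB : HwRelPerf p n R B), ∃ σ : B →+* (S ⊗[R] S') ⧸ K,
          ∀ b, σ (b ^ p ^ n) = Ideal.Quotient.mk K (f b) := by
      intro B _ _ _ f hB
      let g : B →+* (S ⊗[R] S') ⧸ K := (Ideal.Quotient.mk K).comp f.toRingHom
      have hle : ∀ b ∈ RingHom.ker (iterateFrobenius B p n), g b = 0 := by
        intro b hb
        have hb' := hB.2 b hb
        have : Ideal.span (algebraMap R B '' {r | r ^ p ^ n = 0}) ≤ RingHom.ker g := by
          rw [Ideal.span_le]
          rintro _ ⟨r, hr, rfl⟩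
          simp only [SetLike.mem_coe, RingHom.mem_ker]
          change Ideal.Quotient.mk K (f (algebraMap R B r)) = 0
          rw [f.commutes, Ideal.Quotient.eq_zero_iff_mem]
          exact Ideal.subset_span ⟨r, hr, rfl⟩
        exact this hb'
      have hF : Function.Surjective (iterateFrobenius B p n) := hB.1
      refine ⟨RingHom.liftOfSurjective (iterateFrobenius B p n) hF ⟨g, hle⟩, ?_⟩
      intro b
      exact RingHom.liftOfRightInverse_comp_apply _ _ _ ⟨g, hle⟩ b
    obtain ⟨σ, hσ1⟩ := hσ S Algebra.TensorProduct.includeLeft h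
    obtain ⟨σ', hσ2⟩ := hσ S' Algebra.TensorProduct.includeRight h'
    have hcomm : σ.comp (algebraMap R S) = σ'.comp (algebraMap R S') := by
      ext r
      obtain ⟨y, rfl⟩ := hsp r
      simp only [RingHom.comp_apply, map_pow (algebraMap R S), map_pow (algebraMap R S'), hσ1, hσ2,
        AlgHom.commutes]
    obtain ⟨τ, hτ0⟩ := hw_tensor_lift σ σ' hcomm
    have hτ : ∀ x, τ (x ^ p ^ n) = Ideal.Quotient.mk K x := by
      intro x
      induction x with
      | zero => rw [zero_pow hq, map_zero, map_zero]
      | add x y hx hy => rw [add_pow_char_pow, map_add, hx, hy, map_add]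
      | tmul x y =>
        rw [Algebra.TensorProduct.tmul_pow, hτ0, hσ1, hσ2, ← map_mul]
        simp
    intro s hs
    have := hτ s
    rw [hs, map_zero] at this
    exact Ideal.Quotient.eq_zero_iff_mem.1 this.symm

/-! ### Part 2: Witt vectors with coefficients in an ideal -/

section HwWitt

open MvPolynomial

variable (p : ℕ) [hp : Fact p.Prime]

lemma hw_wittSub_ghost (n : ℕ) :
    C ((p : ℤ) ^ n) * WittVector.wittSub p n =
      (∑ i ∈ Finset.range (n + 1), C ((p : ℤ) ^ i) * (X ((0 : Fin 2), i)) ^ p ^ (n - i))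
      - (∑ i ∈ Finset.range (n + 1), C ((p : ℤ) ^ i) * (X ((1 : Fin 2), i)) ^ p ^ (n - i))
      - ∑ i ∈ Finset.range n, C ((p : ℤ) ^ i) * WittVector.wittSub p i ^ p ^ (n - i) := by
  have h := wittStructureInt_prop p (X 0 - X 1 : MvPolynomial (Fin 2) ℤ) n
  rw [wittPolynomial_eq_sum_C_mul_X_pow] at h
  simp only [map_sub, bind₁_X_right, map_sum, map_mul, map_pow, rename_X,
    algHom_C, algebraMap_eq] at h
  rw [Finset.sum_range_succ] at h
  simp only [Nat.sub_self, pow_zero, pow_one] at h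
  simp only [map_pow]
  rw [← h]
  simp only [WittVector.wittSub]
  ring

lemma hw_wittSub_wh (n : ℕ) :
    IsWeightedHomogeneous (fun bi : Fin 2 × ℕ => p ^ bi.2) (WittVector.wittSub p n) (p ^ n) := by
  induction n using Nat.strong_induction_on with
  | _ n ih =>
  have hpow : ∀ i ≤ n, p ^ (n - i) • p ^ i = p ^ n := by
    intro i hi
    rw [smul_eq_mul, ← pow_add, Nat.sub_add_cancel hi]
  have hC : ∀ (i : ℕ) (f : MvPolynomial (Fin 2 × ℕ) ℤ), i ≤ n →
      IsWeightedHomogeneous (fun bi : Fin 2 × ℕ => p ^ bi.2) f (p ^ i) →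
      IsWeightedHomogeneous (fun bi : Fin 2 × ℕ => p ^ bi.2) (C ((p : ℤ) ^ i) * f ^ p ^ (n - i))
        (p ^ n) := by
    intro i f hi hf
    have h1 := (isWeightedHomogeneous_C (fun bi : Fin 2 × ℕ => p ^ bi.2) ((p : ℤ) ^ i)).mul
      (hf.pow (p ^ (n - i)))
    rwa [hpow i hi, zero_add] at h1
  have key : IsWeightedHomogeneous (fun bi : Fin 2 × ℕ => p ^ bi.2)
      (C ((p : ℤ) ^ n) * WittVector.wittSub p n) (p ^ n) := by
    rw [hw_wittSub_ghost]
    refine Submodule.sub_mem (weightedHomogeneousSubmodule ℤ _ _) (Submodule.sub_mem _ ?_ ?_) ?_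
    · refine Submodule.sum_mem _ fun i hi => hC i _ (by simpa [Nat.lt_succ_iff] using hi) ?_
      exact isWeightedHomogeneous_X ℤ (fun bi : Fin 2 × ℕ => p ^ bi.2) ((0 : Fin 2), i)
    · refine Submodule.sum_mem _ fun i hi => hC i _ (by simpa [Nat.lt_succ_iff] using hi) ?_
      exact isWeightedHomogeneous_X ℤ (fun bi : Fin 2 × ℕ => p ^ bi.2) ((1 : Fin 2), i)
    · refine Submodule.sum_mem _ fun i hi => ?_
      have hi' : i < n := by simpa using hi
      exact hC i _ hi'.le (ih i hi')
  intro d hd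
  apply key
  rw [coeff_C_mul]
  exact mul_ne_zero (pow_ne_zero _ (by exact_mod_cast hp.out.ne_zero)) hd

lemma hw_sub_mem_filtration {A : Type*} [CommRing A] (F : ℕ → Ideal A) (h0 : F 0 = ⊤)
    (hmul : ∀ a b, F a * F b ≤ F (a + b)) (x y : WittVector p A)
    (hx : ∀ i, x.coeff i ∈ F (p ^ i)) (hy : ∀ i, y.coeff i ∈ F (p ^ i)) (n : ℕ) :
    (x - y).coeff n ∈ F (p ^ n) := by
  have hpow : ∀ (a : A) (k e : ℕ), a ∈ F k → a ^ e ∈ F (e * k) := by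
    intro a k e ha
    induction e with
    | zero => simp [h0]
    | succ e ih =>
      rw [pow_succ, Nat.succ_mul]
      exact hmul _ _ (Ideal.mul_mem_mul ih ha)
  have hprod : ∀ (s : Finset (Fin 2 × ℕ)) (v : Fin 2 × ℕ → A) (w : Fin 2 × ℕ → ℕ),
      (∀ i ∈ s, v i ∈ F (w i)) → ∏ i ∈ s, v i ∈ F (∑ i ∈ s, w i) := by
    intro s v w h
    induction s using Finset.cons_induction with
    | empty => simp [h0]
    | cons a s ha ih =>
      rw [Finset.prod_cons, Finset.sum_cons]
      exact hmul _ _ (Ideal.mul_mem_mul (h a (by simp)) (ih fun i hi => h i (by simp [hi])))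
  rw [WittVector.sub_coeff, WittVector.peval, aeval_def, eval₂_eq]
  refine Submodule.sum_mem _ fun d hd => Ideal.mul_mem_left _ _ ?_
  have hw := hw_wittSub_wh p n (mem_support_iff.1 hd)
  rw [← hw, Finsupp.weight_apply, Finsupp.sum]
  refine hprod _ _ _ fun i _ => ?_
  rw [smul_eq_mul]
  apply hpow
  obtain ⟨b, i⟩ := i
  fin_cases b
  · exact hx i
  · exact hy i

lemma hw_wittSub_lin (n : ℕ) :
    WittVector.wittSub p n - (X (0, n) - X (1, n)) ∈ idealOfVars (Fin 2 × ℕ) ℤ ^ 2 := by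
  have hX : ∀ i, (X i : MvPolynomial (Fin 2 × ℕ) ℤ) ∈ idealOfVars (Fin 2 × ℕ) ℤ :=
    fun i => Ideal.subset_span ⟨i, rfl⟩
  have hS : ∀ i, WittVector.wittSub p i ∈ idealOfVars (Fin 2 × ℕ) ℤ := by
    intro i
    rw [← pow_one (idealOfVars (Fin 2 × ℕ) ℤ), mem_pow_idealOfVars_iff']
    intro x hx
    have : x = 0 := (Finsupp.degree_eq_zero_iff x).1 (by simpa using hx)
    subst this
    exact WittVector.constantCoeff_wittSub p i
  have hsq : ∀ (i : ℕ) (f : MvPolynomial (Fin 2 × ℕ) ℤ), i < n → f ∈ idealOfVars (Fin 2 × ℕ) ℤ →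
      C ((p : ℤ) ^ i) * f ^ p ^ (n - i) ∈ idealOfVars (Fin 2 × ℕ) ℤ ^ 2 := by
    intro i f hi hf
    refine Ideal.mul_mem_left _ _ (Ideal.pow_le_pow_right ?_ (Ideal.pow_mem_pow hf _))
    calc 2 ≤ p := hp.out.two_le
      _ = p ^ 1 := (pow_one p).symm
      _ ≤ p ^ (n - i) := Nat.pow_le_pow_right hp.out.pos (by omega)
  have key : C ((p : ℤ) ^ n) * (WittVector.wittSub p n - (X (0, n) - X (1, n))) ∈
      idealOfVars (Fin 2 × ℕ) ℤ ^ 2 := by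
    have : C ((p : ℤ) ^ n) * (WittVector.wittSub p n - (X (0, n) - X (1, n))) =
      (∑ i ∈ Finset.range n, C ((p : ℤ) ^ i) * (X ((0 : Fin 2), i)) ^ p ^ (n - i))
      - (∑ i ∈ Finset.range n, C ((p : ℤ) ^ i) * (X ((1 : Fin 2), i)) ^ p ^ (n - i))
      - ∑ i ∈ Finset.range n, C ((p : ℤ) ^ i) * WittVector.wittSub p i ^ p ^ (n - i) := by
      rw [mul_sub, hw_wittSub_ghost, Finset.sum_range_succ, Finset.sum_range_succ]
      simp only [Nat.sub_self, pow_zero, pow_one]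
      ring
    rw [this]
    refine Ideal.sub_mem _ (Ideal.sub_mem _ ?_ ?_) ?_ <;>
    refine Submodule.sum_mem _ fun i hi => hsq i _ (by simpa using hi) ?_
    exacts [hX _, hX _, hS _]
  rw [mem_pow_idealOfVars_iff'] at key ⊢
  intro x hx
  have := key x hx
  rw [coeff_C_mul] at this
  exact (mul_eq_zero.1 this).resolve_left (pow_ne_zero _ (by exact_mod_cast hp.out.ne_zero))

lemma hw_sub_lin {A : Type*} [CommRing A] (K : Ideal A) (x y : WittVector p A)
    (hx : ∀ i, x.coeff i ∈ K) (hy : ∀ i, y.coeff i ∈ K) (n : ℕ) :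
    (x - y).coeff n - (x.coeff n - y.coeff n) ∈ K ^ 2 := by
  set φ : MvPolynomial (Fin 2 × ℕ) ℤ →ₐ[ℤ] A := aeval (Function.uncurry ![x.coeff, y.coeff]) with hφ
  have h1 : (idealOfVars (Fin 2 × ℕ) ℤ).map φ.toRingHom ≤ K := by
    rw [idealOfVars, Ideal.map_span, Ideal.span_le]
    rintro _ ⟨_, ⟨⟨b, i⟩, rfl⟩, rfl⟩
    fin_cases b
    · simpa [hφ] using hx i
    · simpa [hφ] using hy i
  have h2 := Ideal.mem_map_of_mem φ.toRingHom (hw_wittSub_lin p n)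
  rw [Ideal.map_pow] at h2
  have h3 := Ideal.pow_right_mono h1 2 h2
  rw [WittVector.sub_coeff, WittVector.peval]
  simpa [hφ] using h3

/-- Finite Witt vectors with coefficients in a nilpotent ideal. -/
noncomputable def hwHat {A : Type*} [CommRing A] (K : Ideal A) (hK : IsNilpotent K) :
    AddSubgroup (WittVector p A) :=
  AddSubgroup.ofSub {x | (∀ i, x.coeff i ∈ K) ∧ ∃ M, ∀ i ≥ M, x.coeff i = 0}
    ⟨0, by simp⟩ (by
      rintro x ⟨hx, M1, hM1⟩ y ⟨hy, M2, hM2⟩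
      obtain ⟨N, hN⟩ := hK
      rw [← sub_eq_add_neg]
      obtain ⟨M, hMx, hMy⟩ : ∃ M, (∀ i ≥ M, x.coeff i = 0) ∧ ∀ i ≥ M, y.coeff i = 0 :=
        ⟨max M1 M2, fun i hi => hM1 i (le_trans (le_max_left _ _) hi),
          fun i hi => hM2 i (le_trans (le_max_right _ _) hi)⟩
      have hc : 0 < p ^ M := pow_pos hp.out.pos _
      have hceil : ∀ k, 1 ≤ k → 1 ≤ (k + (p ^ M - 1)) / p ^ M := by
        intro k hk
        rw [Nat.le_div_iff_mul_le hc]; omega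
      have hmem : ∀ z : WittVector p A, (∀ i, z.coeff i ∈ K) → (∀ i ≥ M, z.coeff i = 0) →
          ∀ i, z.coeff i ∈ K ^ ((p ^ i + (p ^ M - 1)) / p ^ M) := by
        intro z hz hz' i
        by_cases hi : M ≤ i
        · rw [hz' i hi]; exact zero_mem _
        · have : (p ^ i + (p ^ M - 1)) / p ^ M = 1 := by
            have h1 : p ^ i ≤ p ^ M := Nat.pow_le_pow_right hp.out.pos (by omega)
            have h2 : 0 < p ^ i := pow_pos hp.out.pos _
            rw [Nat.div_eq_iff hc]
            omega
          rw [this, pow_one]; exact hz i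
      have := hw_sub_mem_filtration p (fun k => K ^ ((k + (p ^ M - 1)) / p ^ M))
        (by
          have : (0 + (p ^ M - 1)) / p ^ M = 0 := Nat.div_eq_of_lt (by omega)
          simp only [this, pow_zero, Ideal.one_eq_top])
        (by
          intro a b
          rw [← pow_add]
          apply Ideal.pow_le_pow_right
          rw [← Nat.lt_succ_iff, Nat.div_lt_iff_lt_mul hc]
          have h1 := Nat.lt_div_mul_add (a := a + (p ^ M - 1)) hc
          have h2 := Nat.lt_div_mul_add (a := b + (p ^ M - 1)) hc
          rw [Nat.succ_mul, Nat.add_mul]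
          omega)
        x y (hmem x hx hMx) (hmem y hy hMy)
      refine ⟨fun i => ?_, M + N, fun i hi => ?_⟩
      · have h1 := Ideal.pow_le_pow_right (hceil (p ^ i) (Nat.one_le_pow _ _ hp.out.pos)) (this i)
        rwa [pow_one] at h1
      · have h1 : N ≤ (p ^ i + (p ^ M - 1)) / p ^ M := by
          rw [Nat.le_div_iff_mul_le hc]
          have : p ^ i = p ^ (i - M) * p ^ M := by rw [← pow_add]; congr 1; omega
          have h3 : N ≤ p ^ (i - M) := le_trans (by omega : N ≤ i - M)
            (Nat.lt_pow_self hp.out.one_lt).le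
          calc N * p ^ M ≤ p ^ (i - M) * p ^ M := Nat.mul_le_mul_right _ h3
            _ = p ^ i := this.symm
            _ ≤ _ := Nat.le_add_right _ _
        have h2 := Ideal.pow_le_pow_right h1 (this i)
        rw [hN] at h2
        simpa using h2)

lemma mem_hwHat {A : Type*} [CommRing A] (K : Ideal A) (hK : IsNilpotent K) (x : WittVector p A) :
    x ∈ hwHat p K hK ↔ (∀ i, x.coeff i ∈ K) ∧ ∃ M, ∀ i ≥ M, x.coeff i = 0 := Iff.rfl

/-- Pairs of a finite Witt vector and its linearisation. -/
noncomputable def hwLin {A : Type*} [CommRing A] (K : Ideal A) (hK : IsNilpotent K) :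
    AddSubgroup (WittVector p A × (ℕ → A)) :=
  AddSubgroup.ofSub {x | x.1 ∈ hwHat p K hK ∧ ∀ i, x.1.coeff i - x.2 i ∈ K ^ 2}
    ⟨0, zero_mem _, by simp⟩ (by
      rintro ⟨x, v⟩ ⟨hx, hv⟩ ⟨y, w⟩ ⟨hy, hw⟩
      rw [← sub_eq_add_neg]
      refine ⟨sub_mem hx hy, fun i => ?_⟩
      have h1 := hw_sub_lin p K x y hx.1 hy.1 i
      have h2 := add_mem h1 (sub_mem (hv i) (hw i))
      simp only [Prod.fst_sub, Prod.snd_sub, Pi.sub_apply] at h2 ⊢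
      convert h2 using 1
      ring)

lemma hw_sum_lin {A B : Type*} [CommRing A] [CommRing B] {ι : Type*} [Fintype ι]
    (f : ι → A →+* B) (s : ι → ℤ) (K : Ideal A) (hK : IsNilpotent K) (L : Ideal B)
    (hL : IsNilpotent L) (hf : ∀ i, ∀ a ∈ K, f i a ∈ L) (x : WittVector p A)
    (hx : x ∈ hwHat p K hK) :
    (∑ i, s i • WittVector.map (f i) x) ∈ hwHat p L hL ∧
    ∀ m, (∑ i, s i • WittVector.map (f i) x).coeff m - ∑ i, s i • f i (x.coeff m) ∈ L ^ 2 := by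
  have h : ∑ i, s i • ((WittVector.map (f i) x, fun m => f i (x.coeff m)) :
      WittVector p B × (ℕ → B)) ∈ hwLin p L hL := by
    refine sum_mem fun i _ => zsmul_mem ?_ _
    obtain ⟨hx1, M, hM⟩ := hx
    refine ⟨⟨fun m => ?_, M, fun m hm => ?_⟩, fun m => ?_⟩
    · rw [WittVector.map_coeff]; exact hf i _ (hx1 m)
    · rw [WittVector.map_coeff, hM m hm, map_zero]
    · rw [WittVector.map_coeff, sub_self]; exact zero_mem _
  obtain ⟨h1, h2⟩ := h
  simp only [Prod.fst_sum, Prod.snd_sum, Prod.smul_fst, Prod.smul_snd, Finset.sum_apply,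
    Pi.smul_apply] at h1 h2
  exact ⟨h1, h2⟩

/-- The main induction on the nilpotent filtration. -/
lemma hw_main {R A B C : Type*} [CommRing R] [CommRing A] [CommRing B] [CommRing C]
    [Algebra R A] [Algebra R B] [Algebra R C] {ι κ : Type*} [Fintype ι] [Fintype κ]
    (f : ι → A →ₐ[R] B) (s : ι → ℤ) (g : κ → B →ₐ[R] C) (t : κ → ℤ)
    (J : Ideal R) (hJ : IsNilpotent J)
    (hE : ∀ k, ∀ x ∈ (J ^ k).map (algebraMap R B),
      ∑ i, t i • g i x ∈ (J ^ (k + 1)).map (algebraMap R C) →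
      ∃ y ∈ (J ^ k).map (algebraMap R A),
        x - ∑ i, s i • f i y ∈ (J ^ (k + 1)).map (algebraMap R B))
    (hdd : ∀ y : WittVector p A, ∑ j, t j • WittVector.map (g j : B →+* C)
      (∑ i, s i • WittVector.map (f i : A →+* B) y) = 0)
    (x : WittVector p B) (hx1 : ∀ i, x.coeff i ∈ J.map (algebraMap R B))
    (hx2 : ∃ M, ∀ i ≥ M, x.coeff i = 0)
    (hx3 : ∑ j, t j • WittVector.map (g j : B →+* C) x = 0) :
    ∃ y : WittVector p A, ((∀ i, y.coeff i ∈ J.map (algebraMap R A)) ∧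
      ∃ M, ∀ i ≥ M, y.coeff i = 0) ∧ ∑ i, s i • WittVector.map (f i : A →+* B) y = x := by
  obtain ⟨N, hN⟩ := hJ
  have hnilA : ∀ k, IsNilpotent ((J ^ (k + 1)).map (algebraMap R A)) := by
    intro k
    refine ⟨N, ?_⟩
    rw [← Ideal.map_pow, ← pow_mul, mul_comm, pow_mul, hN,
      zero_pow (Nat.succ_ne_zero k), Ideal.zero_eq_bot, Ideal.map_bot, Ideal.zero_eq_bot]
  have hnilB : ∀ k, IsNilpotent ((J ^ (k + 1)).map (algebraMap R B)) := by
    intro k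
    refine ⟨N, ?_⟩
    rw [← Ideal.map_pow, ← pow_mul, mul_comm, pow_mul, hN,
      zero_pow (Nat.succ_ne_zero k), Ideal.zero_eq_bot, Ideal.map_bot, Ideal.zero_eq_bot]
  have hnilC : ∀ k, IsNilpotent ((J ^ (k + 1)).map (algebraMap R C)) := by
    intro k
    refine ⟨N, ?_⟩
    rw [← Ideal.map_pow, ← pow_mul, mul_comm, pow_mul, hN,
      zero_pow (Nat.succ_ne_zero k), Ideal.zero_eq_bot, Ideal.map_bot, Ideal.zero_eq_bot]
  have hmapf : ∀ k i, ∀ a ∈ (J ^ k).map (algebraMap R A),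
      (f i : A →+* B) a ∈ (J ^ k).map (algebraMap R B) := by
    intro k i a ha
    have := Ideal.mem_map_of_mem (f i : A →+* B) ha
    rwa [Ideal.map_map, AlgHom.comp_algebraMap] at this
  have hmapg : ∀ k i, ∀ a ∈ (J ^ k).map (algebraMap R B),
      (g i : B →+* C) a ∈ (J ^ k).map (algebraMap R C) := by
    intro k i a ha
    have := Ideal.mem_map_of_mem (g i : B →+* C) ha
    rwa [Ideal.map_map, AlgHom.comp_algebraMap] at this
  have hsqB : ∀ k, (J ^ (k + 1)).map (algebraMap R B) ^ 2 ≤ (J ^ (k + 1 + 1)).map (algebraMap R B) := by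
    intro k
    rw [← Ideal.map_pow, ← pow_mul]
    exact Ideal.map_mono (Ideal.pow_le_pow_right (by omega))
  have hsqC : ∀ k, (J ^ (k + 1)).map (algebraMap R C) ^ 2 ≤ (J ^ (k + 1 + 1)).map (algebraMap R C) := by
    intro k
    rw [← Ideal.map_pow, ← pow_mul]
    exact Ideal.map_mono (Ideal.pow_le_pow_right (by omega))
  have claim : ∀ r k, N ≤ k + 1 + r → ∀ x : WittVector p B, x ∈ hwHat p _ (hnilB k) →
      ∑ j, t j • WittVector.map (g j : B →+* C) x = 0 →
      ∃ y ∈ hwHat p _ (hnilA k), ∑ i, s i • WittVector.map (f i : A →+* B) y = x := by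
    intro r
    induction r with
    | zero =>
      intro k hk x hx _
      refine ⟨0, zero_mem _, ?_⟩
      have hz : J ^ (k + 1) = ⊥ := by
        rw [← Nat.sub_add_cancel (show N ≤ k + 1 from hk), pow_add, hN, mul_zero, Ideal.zero_eq_bot]
      have : x = 0 := by
        ext i
        have := hx.1 i
        rw [hz, Ideal.map_bot] at this
        simpa using this
      simp [this]
    | succ r ih =>
      intro k hk x hx hx0
      obtain ⟨M, hM⟩ := hx.2
      have hlin := (hw_sum_lin p (fun j => (g j : B →+* C)) t _ (hnilB k) _ (hnilC k)
        (hmapg (k + 1)) x hx).2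
      have hy : ∀ m, ∃ y ∈ (J ^ (k + 1)).map (algebraMap R A),
          x.coeff m - ∑ i, s i • f i y ∈ (J ^ (k + 1 + 1)).map (algebraMap R B) := by
        intro m
        apply hE _ _ (hx.1 m)
        have := hsqC k (hlin m)
        rw [hx0, WittVector.zero_coeff, zero_sub, neg_mem_iff] at this
        exact this
      choose y hy1 hy2 using hy
      let Y : WittVector p A := WittVector.mk p (fun m => if m < M then y m else 0)
      have hY : Y ∈ hwHat p _ (hnilA k) := by
        refine ⟨fun i => ?_, M, fun i hi => ?_⟩
        · simp only [Y, WittVector.coeff_mk]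
          split_ifs
          · exact hy1 i
          · exact zero_mem _
        · simp only [Y, WittVector.coeff_mk]
          rw [if_neg (by omega)]
      have hY2 : ∀ m, x.coeff m - ∑ i, s i • f i (Y.coeff m) ∈
          (J ^ (k + 1 + 1)).map (algebraMap R B) := by
        intro m
        simp only [Y, WittVector.coeff_mk]
        split_ifs with h
        · exact hy2 m
        · rw [hM m (by omega)]; simp
      obtain ⟨hd1, hd2⟩ := hw_sum_lin p (fun j => (f j : A →+* B)) s _ (hnilA k) _ (hnilB k)
        (hmapf (k + 1)) Y hY
      set D := ∑ i, s i • WittVector.map (f i : A →+* B) Y with hD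
      have hsub : x - D ∈ hwHat p _ (hnilB (k + 1)) := by
        refine ⟨fun m => ?_, (sub_mem hx hd1).2⟩
        have e1 := hsqB k (hw_sub_lin p _ x D hx.1 hd1.1 m)
        have e2 := hsqB k (hd2 m)
        have e3 := hY2 m
        have := add_mem (sub_mem e1 e2) e3
        convert this using 1
        simp only [RingHom.coe_coe]
        ring
      obtain ⟨y', hy', hy'2⟩ := ih (k + 1) (by omega) (x - D) hsub (by
        have := hdd Y
        rw [← hD] at this
        simp only [map_sub, smul_sub, Finset.sum_sub_distrib]
        rw [this, hx0, sub_zero])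
      refine ⟨Y + y', add_mem hY ⟨fun i => ?_, hy'.2⟩, ?_⟩
      · exact Ideal.map_mono (Ideal.pow_le_pow_right (by omega)) (hy'.1 i)
      · simp only [map_add, smul_add, Finset.sum_add_distrib]
        rw [hy'2, ← hD]; abel
  have h1 : J ^ (0 + 1) = J := by simp
  obtain ⟨y, hy1, hy2⟩ := claim N 0 (by omega) x ⟨by rw [h1]; exact hx1, hx2⟩ hx3
  refine ⟨y, ?_, hy2⟩
  have := (mem_hwHat p _ _ _).1 hy1
  rwa [h1] at this

end HwWitt

/-! ### Part 3: the Čech complex -/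

section HwCech

lemma hw_dd {X0 X1 X2 : Type*} [AddCommGroup X0] [AddCommGroup X1] [AddCommGroup X2] (n : ℕ)
    (f : Fin (n + 1) → X0 →+ X1) (g : Fin (n + 2) → X1 →+ X2)
    (h : ∀ i j : Fin (n + 1), i ≤ j → ∀ x, g j.succ (f i x) = g i.castSucc (f j x)) (x : X0) :
    ∑ j : Fin (n + 2), (-1 : ℤ) ^ (j : ℕ) • g j (∑ i : Fin (n + 1), (-1 : ℤ) ^ (i : ℕ) • f i x) = 0 := by
  simp only [map_sum, map_zsmul, Finset.smul_sum]
  rw [← Finset.sum_product']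
  let P := Fin (n + 2) × Fin (n + 1)
  let S : Finset P := {ij : P | (ij.2 : ℕ) < (ij.1 : ℕ)}
  rw [Finset.univ_product_univ, ← Finset.sum_add_sum_compl S, ← eq_neg_iff_add_eq_zero,
    ← Finset.sum_neg_distrib]
  let φ : ∀ ij : P, ij ∈ S → P := fun ij hij =>
    (ij.2.castSucc, ij.1.pred (by
      rintro h0
      simp only [S, Finset.mem_filter, h0] at hij
      simp at hij))
  apply Finset.sum_bij φ
  · rintro ⟨i, j⟩ hij
    simp only [S, φ, Finset.mem_filter, Finset.compl_filter, Finset.mem_univ, true_and,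
      Fin.val_castSucc, Fin.val_pred] at hij ⊢
    omega
  · rintro ⟨i, j⟩ hij ⟨i', j'⟩ hij' he
    have he1 : j.castSucc = j'.castSucc := congrArg Prod.fst he
    have he3 : (i : ℕ) - 1 = (i' : ℕ) - 1 := congrArg (fun z : P => (z.2 : ℕ)) he
    have he2 : i = i' := by
      simp only [S, Finset.mem_filter, Finset.mem_univ, true_and] at hij hij'
      ext
      omega
    rw [Fin.castSucc_inj.1 he1, he2]
  · rintro ⟨i', j'⟩ hij'
    simp only [S, Finset.compl_filter, Finset.mem_filter, Finset.mem_univ, true_and, not_lt] at hij'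
    refine ⟨(j'.succ, i'.castLT (by omega)), ?_, ?_⟩
    · simp only [S, Finset.mem_filter, Finset.mem_univ, true_and, Fin.val_castLT, Fin.val_succ]
      omega
    · simp [φ]
  · rintro ⟨i, j⟩ hij
    simp only [S, Finset.mem_filter, Finset.mem_univ, true_and] at hij
    have hi0 : i ≠ 0 := by rintro rfl; simp at hij
    obtain ⟨i, rfl⟩ := Fin.exists_succ_eq.2 hi0
    simp only [φ, Fin.pred_succ, Fin.val_castSucc, Fin.val_succ]
    rw [h j i (by simp at hij; rw [Fin.le_def]; omega), pow_succ, smul_smul, smul_smul, ← neg_smul]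
    congr 1
    ring

variable {R : Type*} [CommRing R] (R' : Type*) [CommRing R'] [Algebra R R']

/-- extension of a family of coface maps by one tensor factor. -/
noncomputable def hwExt {A B : Type*} [CommRing A] [Algebra R A] [CommRing B] [Algebra R B] {k : ℕ}
    (f : Fin k → A →ₐ[R] B) (ι : A ⊗[R] R' →ₐ[R] B ⊗[R] R') :
    Fin (k + 1) → A ⊗[R] R' →ₐ[R] B ⊗[R] R' := fun i =>
  Fin.lastCases ι (fun j => Algebra.TensorProduct.map (f j) (AlgHom.id R R')) i

lemma hwExt_pair {A : Type*} [CommRing A] [Algebra R A] {k : ℕ}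
    (f : Fin (k + 1) → A →ₐ[R] A ⊗[R] R')
    (h : ∀ i j : Fin (k + 1), i ≤ j → ∀ x,
      hwExt R' f Algebra.TensorProduct.includeLeft j.succ (f i x) =
        hwExt R' f Algebra.TensorProduct.includeLeft i.castSucc (f j x))
    (i j : Fin (k + 2)) (hij : i ≤ j) (x : A ⊗[R] R') :
    hwExt R' (hwExt R' f Algebra.TensorProduct.includeLeft) Algebra.TensorProduct.includeLeft j.succ
      (hwExt R' f Algebra.TensorProduct.includeLeft i x) =
    hwExt R' (hwExt R' f Algebra.TensorProduct.includeLeft) Algebra.TensorProduct.includeLeft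
      i.castSucc (hwExt R' f Algebra.TensorProduct.includeLeft j x) := by
  induction j using Fin.lastCases with
  | last =>
    rw [Fin.succ_last]
    simp only [hwExt, Fin.lastCases_last, Fin.lastCases_castSucc,
      Algebra.TensorProduct.includeLeft_apply, Algebra.TensorProduct.map_tmul, map_one]
  | cast j =>
    induction i using Fin.lastCases with
    | last =>
      exfalso
      have := j.2
      rw [Fin.le_def] at hij
      simp at hij
      omega
    | cast i =>
      rw [Fin.succ_castSucc]
      simp only [hwExt, Fin.lastCases_last, Fin.lastCases_castSucc]
      simp only [hwExt] at h
      induction x with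
      | zero => simp
      | add x y hx hy => simp only [map_add, hx, hy]
      | tmul a b =>
        simp only [Algebra.TensorProduct.map_tmul]
        rw [h i j (by simpa using hij)]
        simp

lemma hw_mem_map_iff {M : Type*} [CommRing M] [Algebra R M] (J : Ideal R) (x : M) :
    x ∈ J.map (algebraMap R M) ↔ (Ideal.Quotient.mk J 1) ⊗ₜ[R] x = (0 : (R ⧸ J) ⊗[R] M) := by
  rw [← (TensorProduct.quotTensorEquivQuotSMul M J).map_eq_zero_iff,
    TensorProduct.quotTensorEquivQuotSMul_mk_tmul, one_smul, Submodule.Quotient.mk_eq_zero,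
    Ideal.smul_top_eq_map]
  rfl

/-- The twisted differential -/
noncomputable def hwD' {M : Type*} [AddCommGroup M] [Module R M] (D : M →ₗ[R] M ⊗[R] R') (ε : R) :
    M ⊗[R] R' →ₗ[R] (M ⊗[R] R') ⊗[R] R' :=
  D.rTensor R' + ε • (TensorProduct.mk R (M ⊗[R] R') R').flip 1

/-- multiply the last two factors. -/
noncomputable def hwMu (M : Type*) [AddCommGroup M] [Module R M] :
    (M ⊗[R] R') ⊗[R] R' →ₗ[R] M ⊗[R] R' :=
  (LinearMap.mul' R R').lTensor M ∘ₗ (TensorProduct.assoc R M R' R').toLinearMap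

lemma hw_mu {M : Type*} [AddCommGroup M] [Module R M] (D : M →ₗ[R] M ⊗[R] R') (ε : R)
    (w : (M ⊗[R] R') ⊗[R] R') :
    hwMu R' (M ⊗[R] R') ((hwD' R' D ε).rTensor R' w) =
      D.rTensor R' (hwMu R' M w) + ε • w := by
  induction w with
  | zero => simp
  | add x y hx hy => simp only [map_add, hx, hy, smul_add]; abel
  | tmul z b =>
    induction z with
    | zero => simp
    | add x y hx hy => simp only [TensorProduct.add_tmul, map_add, hx, hy, smul_add]; abel
    | tmul a c =>
      simp [hwD', hwMu, TensorProduct.add_tmul, TensorProduct.smul_tmul']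

lemma hw_exact [Module.FaithfullyFlat R R'] {M : Type*} [AddCommGroup M] [Module R M]
    (D : M →ₗ[R] M ⊗[R] R') (ε : R) (hε : ε * ε = 1) (hdd : ∀ x, hwD' R' D ε (D x) = 0) :
    Function.Exact D (hwD' R' D ε) := by
  apply Module.FaithfullyFlat.rTensor_reflects_exact R R'
  intro w
  constructor
  · intro hw
    have := hw_mu R' D ε w
    rw [hw, map_zero] at this
    refine ⟨-(ε • hwMu R' M w), ?_⟩
    rw [map_neg, map_smul, eq_neg_of_add_eq_zero_left this.symm, smul_neg, neg_neg, smul_smul, hε,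
      one_smul]
  · rintro ⟨z, rfl⟩
    have : (hwD' R' D ε) ∘ₗ D = 0 := LinearMap.ext hdd
    rw [← LinearMap.comp_apply, ← LinearMap.rTensor_comp, this]
    simp

/-- The differential after base change along a module. -/
noncomputable def hwBase (N : Type*) [AddCommGroup N] [Module R N] {M : Type*} [AddCommGroup M]
    [Module R M] (D : M →ₗ[R] M ⊗[R] R') : N ⊗[R] M →ₗ[R] (N ⊗[R] M) ⊗[R] R' :=
  (TensorProduct.assoc R N M R').symm.toLinearMap ∘ₗ D.lTensor N

lemma hw_base_D' (N : Type*) [AddCommGroup N] [Module R N] {M : Type*} [AddCommGroup M]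
    [Module R M] (D : M →ₗ[R] M ⊗[R] R') (ε : R) (a : N) (x : M ⊗[R] R') :
    hwD' R' (hwBase R' N D) ε ((TensorProduct.assoc R N M R').symm (a ⊗ₜ x)) =
      (TensorProduct.assoc R N M R').symm.toLinearMap.rTensor R'
        ((TensorProduct.assoc R N (M ⊗[R] R') R').symm (a ⊗ₜ hwD' R' D ε x)) := by
  induction x with
  | zero => simp
  | add x y hx hy => simp only [map_add, TensorProduct.tmul_add, hx, hy]
  | tmul m b =>
    simp [hwD', hwBase, TensorProduct.tmul_add]

lemma hw_one_tmul {M : Type*} [AddCommGroup M] [Module R M] (J : Ideal R) (z : (R ⧸ J) ⊗[R] M) :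
    ∃ y, z = (Ideal.Quotient.mk J 1) ⊗ₜ[R] y := by
  induction z with
  | zero => exact ⟨0, by simp⟩
  | add x y hx hy =>
    obtain ⟨a, rfl⟩ := hx
    obtain ⟨b, rfl⟩ := hy
    exact ⟨a + b, by rw [TensorProduct.tmul_add]⟩
  | tmul a m =>
    obtain ⟨a, rfl⟩ := Ideal.Quotient.mk_surjective a
    refine ⟨a • m, ?_⟩
    rw [← TensorProduct.smul_tmul]
    congr 1
    rw [← Ideal.Quotient.mk_eq_mk, ← Ideal.Quotient.mk_eq_mk, ← Submodule.Quotient.mk_smul]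
    simp

lemma hw_Q [Module.FaithfullyFlat R R'] {M : Type*} [AddCommGroup M] [Module R M]
    (D : M →ₗ[R] M ⊗[R] R') (ε : R) (hε : ε * ε = 1) (hdd : ∀ x, hwD' R' D ε (D x) = 0)
    (J : Ideal R) (x : M ⊗[R] R')
    (hx : (Ideal.Quotient.mk J 1) ⊗ₜ[R] (hwD' R' D ε x) = 0) :
    ∃ y, (Ideal.Quotient.mk J 1) ⊗ₜ[R] (x - D y) = 0 := by
  have hex := hw_exact R' (hwBase R' (R ⧸ J) D) ε hε (by
    intro z
    induction z with
    | zero => simp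
    | add x y hx hy => simp only [map_add, hx, hy, add_zero]
    | tmul a m =>
      have : hwBase R' (R ⧸ J) D (a ⊗ₜ m) = (TensorProduct.assoc R (R ⧸ J) M R').symm (a ⊗ₜ D m) := by
        simp [hwBase]
      rw [this, hw_base_D', hdd]
      simp)
  have h1 := hw_base_D' R' (R ⧸ J) D ε (Ideal.Quotient.mk J 1) x
  rw [hx, map_zero, map_zero] at h1
  obtain ⟨z, hz⟩ := (hex _).1 h1
  obtain ⟨y, rfl⟩ := hw_one_tmul J z
  refine ⟨y, ?_⟩
  have h2 : hwBase R' (R ⧸ J) D ((Ideal.Quotient.mk J 1) ⊗ₜ y) =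
      (TensorProduct.assoc R (R ⧸ J) M R').symm ((Ideal.Quotient.mk J 1) ⊗ₜ D y) := by
    simp [hwBase]
  rw [h2] at hz
  rw [TensorProduct.tmul_sub, (TensorProduct.assoc R (R ⧸ J) M R').symm.injective hz, sub_self]

lemma hw_neg_one_smul {M : Type*} [AddCommGroup M] [Module R M] (k : ℕ) (x : M) :
    (-1 : ℤ) ^ k • x = (-1 : R) ^ k • x := by
  rcases Nat.even_or_odd k with h | h
  · rw [h.neg_one_pow, h.neg_one_pow, one_smul, one_smul]
  · rw [h.neg_one_pow, h.neg_one_pow, neg_smul, neg_smul, one_smul, one_smul]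

lemma hw_Q_alg [Module.FaithfullyFlat R R'] {A : Type*} [CommRing A] [Algebra R A] {k : ℕ}
    (f : Fin (k + 1) → A →ₐ[R] A ⊗[R] R')
    (h : ∀ i j : Fin (k + 1), i ≤ j → ∀ x,
      hwExt R' f Algebra.TensorProduct.includeLeft j.succ (f i x) =
        hwExt R' f Algebra.TensorProduct.includeLeft i.castSucc (f j x))
    (J : Ideal R) (x : A ⊗[R] R')
    (hx : ∑ j : Fin (k + 2), (-1 : ℤ) ^ (j : ℕ) •
      hwExt R' f Algebra.TensorProduct.includeLeft j x ∈ J.map (algebraMap R _)) :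
    ∃ y : A, x - ∑ j : Fin (k + 1), (-1 : ℤ) ^ (j : ℕ) • f j y ∈ J.map (algebraMap R _) := by
  let D : A →ₗ[R] A ⊗[R] R' := ∑ j : Fin (k + 1), (-1 : R) ^ (j : ℕ) • (f j).toLinearMap
  have hD : ∀ y, D y = ∑ j : Fin (k + 1), (-1 : ℤ) ^ (j : ℕ) • f j y := by
    intro y
    simp only [D, LinearMap.sum_apply, LinearMap.smul_apply, AlgHom.toLinearMap_apply,
      hw_neg_one_smul (R := R)]
  have hD' : ∀ y, hwD' R' D ((-1) ^ (k + 1)) y = ∑ j : Fin (k + 2), (-1 : ℤ) ^ (j : ℕ) •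
      hwExt R' f Algebra.TensorProduct.includeLeft j y := by
    intro y
    rw [Fin.sum_univ_castSucc]
    simp only [hwExt, Fin.lastCases_castSucc, Fin.lastCases_last, hw_neg_one_smul (R := R),
      Fin.val_last, Fin.val_castSucc, hwD', LinearMap.add_apply]
    congr 1
    change LinearMap.rTensorHom R' D y = _
    simp only [D, map_sum, map_smul, LinearMap.sum_apply, LinearMap.smul_apply]
    rfl
  have hdd : ∀ y, hwD' R' D ((-1) ^ (k + 1)) (D y) = 0 := by
    intro y
    rw [hD, hD']
    exact hw_dd k (fun i => (f i).toRingHom.toAddMonoidHom)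
      (fun i => (hwExt R' f Algebra.TensorProduct.includeLeft i).toRingHom.toAddMonoidHom) h y
  rw [hw_mem_map_iff, ← hD'] at hx
  obtain ⟨y, hy⟩ := hw_Q R' D _ (by rw [← mul_pow]; simp) hdd J x hx
  refine ⟨y, ?_⟩
  rw [← hD, hw_mem_map_iff]
  exact hy

lemma hw_Q_alg0 [Module.FaithfullyFlat R R'] (J : Ideal R) (x : R')
    (hx : (1 : R') ⊗ₜ[R] x - x ⊗ₜ[R] (1 : R') ∈ J.map (algebraMap R (R' ⊗[R] R'))) :
    ∃ y : R, x - algebraMap R R' y ∈ J.map (algebraMap R R') := by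
  let D : R →ₗ[R] R ⊗[R] R' := (TensorProduct.mk R R R').flip 1
  have hdd : ∀ y, hwD' R' D (-1) (D y) = 0 := by
    intro y
    have h1 : hwD' R' D (-1) (D y) = (y ⊗ₜ[R] (1 : R')) ⊗ₜ[R] (1 : R') +
      (-1 : R) • ((y ⊗ₜ[R] (1 : R')) ⊗ₜ[R] (1 : R')) := by
      simp [hwD', D]
    rw [h1]
    module
  have e : (TensorProduct.lid R R').toLinearMap.rTensor R' (hwD' R' D (-1) (1 ⊗ₜ x)) =
      (1 : R') ⊗ₜ[R] x - x ⊗ₜ[R] (1 : R') := by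
    simp [hwD', D, sub_eq_add_neg]
  have hx2 : (Ideal.Quotient.mk J 1) ⊗ₜ[R] (hwD' R' D (-1) (1 ⊗ₜ x)) = 0 := by
    rw [hw_mem_map_iff, ← e] at hx
    apply ((TensorProduct.lid R R').rTensor R').lTensor (R ⧸ J) |>.injective
    rw [map_zero]
    exact hx
  obtain ⟨y, hy⟩ := hw_Q R' D (-1) (by simp) hdd J (1 ⊗ₜ x) hx2
  refine ⟨y, ?_⟩
  rw [hw_mem_map_iff]
  have := congrArg ((TensorProduct.lid R R').toLinearMap.lTensor (R ⧸ J)) hy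
  simpa [D, Algebra.algebraMap_eq_smul_one] using this

end HwCech

/-! ### Part 4: assembly -/

section HwFinal

lemma hw_frob_map (p : ℕ) [Fact p.Prime] {S T : Type u} [CommRing S] [CommRing T] (f : S →+* T)
    (x : WittVector p S) :
    WittVector.map f (WittVector.frobenius x) = WittVector.frobenius (WittVector.map f x) := by
  exact WittVector.IsPoly.map (WittVector.frobenius_isPoly p) f x

lemma hw_isHat_map (p n : ℕ) [Fact p.Prime] {S T : Type u} [CommRing S] [CommRing T] (f : S →+* T)
    (x : WittVector p S) (hx : IsHatWKerF p n x) : IsHatWKerF p n (WittVector.map f x) := by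
  obtain ⟨h1, ⟨N, h2⟩, h3⟩ := hx
  refine ⟨fun m => ?_, ⟨N, fun m hm => ?_⟩, ?_⟩
  · rw [WittVector.map_coeff]; exact (h1 m).map f
  · rw [WittVector.map_coeff, h2 m hm, map_zero]
  · have : Function.Semiconj (WittVector.map f) (WittVector.frobenius (p := p) (R := S))
      (WittVector.frobenius (p := p) (R := T)) := hw_frob_map p f
    rw [← (this.iterate_right n) x, h3, map_zero]

lemma hw_isHat_sub (p n : ℕ) [Fact p.Prime] {S : Type u} [CommRing S]
    (x y : WittVector p S) (hx : IsHatWKerF p n x) (hy : IsHatWKerF p n y) :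
    IsHatWKerF p n (x - y) := by
  obtain ⟨h1, ⟨N, h2⟩, h3⟩ := hx
  obtain ⟨k1, ⟨M, k2⟩, k3⟩ := hy
  have hfin : ∀ (z : WittVector p S) (N : ℕ), (∀ m ≥ N, z.coeff m = 0) →
      (Set.range z.coeff).Finite := by
    intro z N hz
    refine ((Set.finite_lt_nat N).image z.coeff |>.insert 0).subset ?_
    rintro _ ⟨m, rfl⟩
    by_cases hm : m < N
    · exact Or.inr ⟨m, hm, rfl⟩
    · exact Or.inl (hz m (by omega))
  let K : Ideal S := Ideal.span (Set.range x.coeff ∪ Set.range y.coeff)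
  have hfg : K.FG := Submodule.fg_span ((hfin x N h2).union (hfin y M k2))
  have hK : IsNilpotent K := by
    rw [hfg.isNilpotent_iff_le_nilradical, Ideal.span_le]
    rintro _ (⟨m, rfl⟩ | ⟨m, rfl⟩)
    · exact h1 m
    · exact k1 m
  have hxK : x ∈ hwHat p K hK := ⟨fun i => Ideal.subset_span (Or.inl ⟨i, rfl⟩), N, h2⟩
  have hyK : y ∈ hwHat p K hK := ⟨fun i => Ideal.subset_span (Or.inr ⟨i, rfl⟩), M, k2⟩
  have := sub_mem hxK hyK
  refine ⟨fun m => ?_, this.2, ?_⟩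
  · exact (hfg.isNilpotent_iff_le_nilradical.1 hK) (this.1 m)
  · rw [iterate_map_sub, h3, k3, sub_zero]

/-- The additive subgroup of `IsHatWKerF` elements. -/
noncomputable def hwKer (p n : ℕ) [Fact p.Prime] (S : Type u) [CommRing S] :
    AddSubgroup (WittVector p S) :=
  AddSubgroup.ofSub {x | IsHatWKerF p n x}
    ⟨0, by
      refine ⟨fun m => ?_, ⟨0, fun m _ => ?_⟩, ?_⟩
      · rw [WittVector.zero_coeff]; exact IsNilpotent.zero
      · rw [WittVector.zero_coeff]
      · rw [iterate_map_zero]⟩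
    (fun x hx y hy => by rw [← sub_eq_add_neg]; exact hw_isHat_sub p n _ _ hx hy)

lemma hw_isHat_sum (p n : ℕ) [Fact p.Prime] {S T : Type u} [CommRing S] [CommRing T] {ι : Type*}
    [Fintype ι] (f : ι → S →+* T) (s : ι → ℤ)
    (x : WittVector p S) (hx : IsHatWKerF p n x) :
    IsHatWKerF p n (∑ i, s i • WittVector.map (f i) x) := by
  change _ ∈ hwKer p n T
  exact sum_mem fun i _ => zsmul_mem (hw_isHat_map p n (f i) x hx) _

lemma hw_isHat_iff (p n : ℕ) [hp : Fact p.Prime] {S : Type u} [CommRing S] (h0 : (p : S) = 0)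
    (x : WittVector p S) : IsHatWKerF p n x ↔ (∀ i, x.coeff i ^ p ^ n = 0) ∧
      ∃ N, ∀ m ≥ N, x.coeff m = 0 := by
  rcases subsingleton_or_nontrivial S with hS | hS
  · have : x = 0 := by ext; exact Subsingleton.elim _ _
    subst this
    refine ⟨fun _ => ⟨fun i => Subsingleton.elim _ _, 0, fun m _ => Subsingleton.elim _ _⟩,
      fun _ => (hwKer p n S).zero_mem⟩
  have := hw_charP p h0
  have key : (⇑(WittVector.frobenius (p := p) (R := S)))^[n] x = 0 ↔
      ∀ i, x.coeff i ^ p ^ n = 0 := by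
    rw [WittVector.ext_iff]
    simp only [WittVector.iterate_frobenius_coeff, WittVector.zero_coeff]
  constructor
  · rintro ⟨h1, h2, h3⟩
    exact ⟨key.1 h3, h2⟩
  · rintro ⟨h1, h2⟩
    exact ⟨fun m => ⟨_, h1 m⟩, h2, key.2 h1⟩

lemma hw_final (p n : ℕ) [hp : Fact p.Prime] {R A B C : Type u} [CommRing R] [CommRing A]
    [CommRing B] [CommRing C]
    [Algebra R A] [Algebra R B] [Algebra R C] {ι κ : Type} [Fintype ι] [Fintype κ]
    (f : ι → A →ₐ[R] B) (s : ι → ℤ) (g : κ → B →ₐ[R] C) (t : κ → ℤ)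
    (h0 : (p : R) = 0) (hB : HwRelPerf p n R B)
    (hQB : ∀ (J : Ideal R) (x : B), ∑ i, t i • g i x ∈ J.map (algebraMap R C) →
      ∃ y : A, x - ∑ i, s i • f i y ∈ J.map (algebraMap R B))
    (hQA : ∀ (J : Ideal R) (y : A), ∑ i, s i • f i y ∈ J.map (algebraMap R B) →
      ∃ y' ∈ J.map (algebraMap R A), ∑ i, s i • f i y' = ∑ i, s i • f i y)
    (hdd : ∀ y : WittVector p A, ∑ j, t j • WittVector.map (g j : B →+* C)
      (∑ i, s i • WittVector.map (f i : A →+* B) y) = 0)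
    (x : WittVector p B) (hx : IsHatWKerF p n x)
    (hx3 : ∑ j, t j • WittVector.map (g j : B →+* C) x = 0) :
    ∃ y : WittVector p A, IsHatWKerF p n y ∧ ∑ i, s i • WittVector.map (f i : A →+* B) y = x := by
  have h0T : ∀ (B : Type u) [CommRing B] [Algebra R B], (p : B) = 0 := by
    intro B _ _
    have := congrArg (algebraMap R B) h0
    simpa using this
  rw [hw_isHat_iff p n (h0T B)] at hx
  obtain ⟨hx1, M, hM⟩ := hx
  have hfin : ∀ i, ∃ T : Set R, T.Finite ∧ (∀ r ∈ T, r ^ p ^ n = 0) ∧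
      x.coeff i ∈ Ideal.span (algebraMap R B '' T) := by
    intro i
    obtain ⟨T, hT1, hT2⟩ := Submodule.mem_span_finite_of_mem_span (hB.2 _ (hx1 i))
    obtain ⟨T', hT', hfin, hTT⟩ := Set.exists_subset_image_finite_and.1
      ⟨(T : Set B), hT1, T.finite_toSet, rfl⟩
    refine ⟨T', hfin, fun r hr => hT' hr, ?_⟩
    rw [← hTT]
    exact hT2
  choose T hT1 hT2 hT3 using hfin
  let U : Set R := ⋃ i ∈ Set.Iio M, T i
  have hU : U.Finite := (Set.finite_Iio M).biUnion fun i _ => hT1 i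
  have hU2 : ∀ r ∈ U, r ^ p ^ n = 0 := by
    intro r hr
    simp only [U, Set.mem_iUnion] at hr
    obtain ⟨i, _, hr⟩ := hr
    exact hT2 i r hr
  let J : Ideal R := Ideal.span U
  have hJfg : J.FG := Submodule.fg_span hU
  have hJ : IsNilpotent J := by
    rw [hJfg.isNilpotent_iff_le_nilradical, Ideal.span_le]
    exact fun r hr => ⟨_, hU2 r hr⟩
  have hJx : ∀ i, x.coeff i ∈ J.map (algebraMap R B) := by
    intro i
    by_cases hi : i < M
    · rw [Ideal.map_span]
      refine Ideal.span_mono (Set.image_mono ?_) (hT3 i)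
      exact Set.subset_biUnion_of_mem (u := T) hi
    · rw [hM i (by omega)]; exact zero_mem _
  have hdf : ∀ (J : Ideal R) (i : ι), ∀ a ∈ J.map (algebraMap R A), f i a ∈ J.map (algebraMap R B) := by
    intro J i a ha
    have := Ideal.mem_map_of_mem (f i : A →+* B) ha
    rwa [Ideal.map_map, AlgHom.comp_algebraMap] at this
  obtain ⟨y, ⟨hy1, hy2⟩, hy3⟩ := hw_main p f s g t J hJ (by
    intro k x hx hdx
    obtain ⟨y0, hy0⟩ := hQB _ x hdx
    have h1 : x - ∑ i, s i • f i y0 ∈ (J ^ k).map (algebraMap R B) :=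
      Ideal.map_mono (Ideal.pow_le_pow_right (by omega)) hy0
    obtain ⟨y, hy, hy'⟩ := hQA (J ^ k) y0 (by
      have := sub_mem hx h1
      rwa [sub_sub_cancel] at this)
    exact ⟨y, hy, by rw [hy']; exact hy0⟩) hdd x hJx ⟨M, hM⟩ hx3
  refine ⟨y, ?_, hy3⟩
  rw [hw_isHat_iff p n (h0T A)]
  refine ⟨fun i => ?_, hy2⟩
  rcases subsingleton_or_nontrivial A with hS | hS
  · exact Subsingleton.elim _ _
  have := hw_charP p (h0T A)
  have hle : J.map (algebraMap R A) ≤ RingHom.ker (iterateFrobenius A p n) := by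
    rw [Ideal.map_span, Ideal.span_le]
    rintro _ ⟨r, hr, rfl⟩
    simp only [SetLike.mem_coe, RingHom.mem_ker, iterateFrobenius_def]
    rw [← map_pow, hU2 r hr, map_zero]
  exact hle (hy1 i)

lemma hw_relPerf_indEtale (p n : ℕ) [hp : Fact p.Prime] (R R' : Type u) [CommRing R] [CommRing R']
    [Algebra R R'] [CharP R p] (hsp : ∀ x : R, ∃ y : R, y ^ p ^ n = x)
    (hie : IsIndEtale R R') : HwRelPerf p n R R' := by
  obtain ⟨P⟩ := hie
  have hi : ∀ i, HwRelPerf p n R (P.A i).carrier := by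
    intro i
    have := P.etale i
    exact hw_relPerf_of_etale p n R _ hsp
  refine ⟨fun s => ?_, fun s hs => ?_⟩
  · obtain ⟨i, y, rfl⟩ := P.jointly_surjective s
    obtain ⟨t, rfl⟩ := (hi i).1 y
    exact ⟨P.toColim i t, by rw [map_pow]⟩
  · obtain ⟨i, y, rfl⟩ := P.jointly_surjective s
    rw [← map_pow] at hs
    let := P.pre
    obtain ⟨j, hij, hj⟩ := P.eventually_zero i _ hs
    rw [map_pow] at hj
    have h1 := (hi j).2 _ hj
    have h2 := Ideal.mem_map_of_mem (P.toColim j : _ →+* R') h1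
    rw [Ideal.map_span] at h2
    have h3 : (P.toColim j : _ →+* R') (P.trans i j hij y) = P.toColim i y :=
      AlgHom.congr_fun (P.toColim_comp i j hij) y
    rw [h3] at h2
    refine Ideal.span_mono ?_ h2
    rintro _ ⟨_, ⟨r, hr, rfl⟩, rfl⟩
    exact ⟨r, hr, ((P.toColim j).commutes r).symm⟩

lemma hw_relPerf_cech (p n : ℕ) [hp : Fact p.Prime] (R R' : Type u) [CommRing R] [CommRing R']
    [Algebra R R'] [CharP R p] (hsp : ∀ x : R, ∃ y : R, y ^ p ^ n = x)
    (hie : IsIndEtale R R') (m : ℕ) : HwRelPerf p n R (cechAlg (R := R) R' m).carrier := by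
  have h := hw_relPerf_indEtale p n R R' hsp hie
  induction m with
  | zero => exact h
  | succ m ih =>
    exact hw_relPerf_tensor p n R (cechAlg (R := R) R' m).carrier R' (CharP.cast_eq_zero R p) hsp ih h

/-- `hwExt` with the last coface. -/
noncomputable def hwExtL {R : Type*} [CommRing R] (R' : Type*) [CommRing R'] [Algebra R R']
    {A : Type*} [CommRing A] [Algebra R A] {k : ℕ}
    (f : Fin k → A →ₐ[R] A ⊗[R] R') :
    Fin (k + 1) → A ⊗[R] R' →ₐ[R] (A ⊗[R] R') ⊗[R] R' :=
  hwExt R' f Algebra.TensorProduct.includeLeft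

/-- The bottom coface maps. -/
noncomputable def hwBot (R : Type*) [CommRing R] (R' : Type*) [CommRing R'] [Algebra R R']
    (i : Fin (0 + 2)) : R' →ₐ[R] R' ⊗[R] R' :=
  Fin.cases Algebra.TensorProduct.includeRight (fun _ => Algebra.TensorProduct.includeLeft) i

lemma hwBot_zero (R : Type*) [CommRing R] (R' : Type*) [CommRing R'] [Algebra R R'] (x : R') :
    hwBot R R' 0 x = 1 ⊗ₜ x := rfl

lemma hwBot_one (R : Type*) [CommRing R] (R' : Type*) [CommRing R'] [Algebra R R'] (x : R') :
    hwBot R R' 1 x = x ⊗ₜ 1 := rfl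

lemma hwBot_pair (R : Type*) [CommRing R] (R' : Type*) [CommRing R'] [Algebra R R']
    (i j : Fin (0 + 2)) (hij : i ≤ j) (x : R') :
    hwExtL R' (hwBot R R') j.succ (hwBot R R' i x) =
      hwExtL R' (hwBot R R') i.castSucc (hwBot R R' j x) := by
  have h2 : ∀ z, hwExtL R' (hwBot R R') (Fin.last 2) z = z ⊗ₜ 1 := by
    intro z
    simp only [hwExtL, hwExt, Fin.lastCases_last, Algebra.TensorProduct.includeLeft_apply]
  have h1 : ∀ (i : Fin 2) z, hwExtL R' (hwBot R R') i.castSucc z =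
      Algebra.TensorProduct.map (hwBot R R' i) (AlgHom.id R R') z := by
    intro i z
    simp only [hwExtL, hwExt, Fin.lastCases_castSucc]
  have e0 : (0 : Fin 2).succ = (1 : Fin 2).castSucc := rfl
  have e1 : (1 : Fin 2).succ = Fin.last 2 := rfl
  have h0 := hwBot_zero R R'
  have h0' := hwBot_one R R'
  fin_cases i <;> fin_cases j
  · change hwExtL R' (hwBot R R') ((0 : Fin 2).succ) (hwBot R R' 0 x) =
      hwExtL R' (hwBot R R') ((0 : Fin 2).castSucc) (hwBot R R' 0 x)
    rw [e0, h1, h1, h0, Algebra.TensorProduct.map_tmul, Algebra.TensorProduct.map_tmul, map_one,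
      map_one]
  · change hwExtL R' (hwBot R R') ((1 : Fin 2).succ) (hwBot R R' 0 x) =
      hwExtL R' (hwBot R R') ((0 : Fin 2).castSucc) (hwBot R R' 1 x)
    rw [e1, h1, h2, h0, h0', Algebra.TensorProduct.map_tmul, map_one, h0]
  · exact absurd hij (by decide)
  · change hwExtL R' (hwBot R R') ((1 : Fin 2).succ) (hwBot R R' 1 x) =
      hwExtL R' (hwBot R R') ((1 : Fin 2).castSucc) (hwBot R R' 1 x)
    rw [e1, h1, h2, h0', Algebra.TensorProduct.map_tmul, map_one, h0']

lemma hw_pair (R R' : Type u) [CommRing R] [CommRing R'] [Algebra R R'] (m : ℕ) :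
    ∀ i j : Fin (m + 1 + 1), i ≤ j → ∀ x : (cechAlg (R := R) R' m).carrier,
      hwExtL R' (A := (cechAlg (R := R) R' m).carrier) (cechIns (R := R) R' m)
          j.succ (cechIns (R := R) R' m i x) =
        hwExtL R' (A := (cechAlg (R := R) R' m).carrier) (cechIns (R := R) R' m)
          i.castSucc (cechIns (R := R) R' m j x) := by
  induction m with
  | zero => exact hwBot_pair R R'
  | succ m ih =>
    intro i j hij x
    exact hwExt_pair R' (A := (cechAlg (R := R) R' m).carrier) (cechIns (R := R) R' m) ih i j hij x

lemma hw_pair' (R R' : Type u) [CommRing R] [CommRing R'] [Algebra R R'] (m : ℕ)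
    (i j : Fin (m + 2)) (hij : i ≤ j) (x : (cechAlg (R := R) R' m).carrier) :
    cechIns (R := R) R' (m + 1) j.succ (cechIns (R := R) R' m i x) =
      cechIns (R := R) R' (m + 1) i.castSucc (cechIns (R := R) R' m j x) :=
  hw_pair R R' m i j hij x

lemma hw_cech_Q (R R' : Type u) [CommRing R] [CommRing R'] [Algebra R R']
    [Module.FaithfullyFlat R R'] (m : ℕ) (J : Ideal R) (x : (cechAlg (R := R) R' (m + 1)).carrier)
    (hx : ∑ j : Fin (m + 1 + 2), (-1 : ℤ) ^ (j : ℕ) • cechIns (R := R) R' (m + 1) j x ∈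
      J.map (algebraMap R _)) :
    ∃ y : (cechAlg (R := R) R' m).carrier,
      x - ∑ j : Fin (m + 2), (-1 : ℤ) ^ (j : ℕ) • cechIns (R := R) R' m j y ∈
        J.map (algebraMap R _) :=
  hw_Q_alg R' (A := (cechAlg (R := R) R' m).carrier) (cechIns (R := R) R' m) (hw_pair R R' m) J x hx

lemma hwBot_Q (R R' : Type u) [CommRing R] [CommRing R'] [Algebra R R']
    [Module.FaithfullyFlat R R'] (J : Ideal R) (x : R')
    (hx : ∑ j : Fin (0 + 2), (-1 : ℤ) ^ (j : ℕ) • hwBot R R' j x ∈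
      J.map (algebraMap R _)) :
    ∃ y : R, x - algebraMap R R' y ∈ J.map (algebraMap R _) := by
  refine hw_Q_alg0 R' J x ?_
  rw [Fin.sum_univ_two, hwBot_zero, hwBot_one] at hx
  simpa [sub_eq_add_neg] using hx

lemma hw_cech_Q0 (R R' : Type u) [CommRing R] [CommRing R'] [Algebra R R']
    [Module.FaithfullyFlat R R'] (J : Ideal R) (x : (cechAlg (R := R) R' 0).carrier)
    (hx : ∑ j : Fin (0 + 2), (-1 : ℤ) ^ (j : ℕ) • cechIns (R := R) R' 0 j x ∈
      J.map (algebraMap R _)) :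
    ∃ y : R, x - algebraMap R (cechAlg (R := R) R' 0).carrier y ∈ J.map (algebraMap R _) := by
  exact hwBot_Q R R' J x hx

lemma hw_cech_dd (R R' : Type u) [CommRing R] [CommRing R'] [Algebra R R'] (m : ℕ)
    (y : (cechAlg (R := R) R' m).carrier) :
    ∑ j : Fin (m + 1 + 2), (-1 : ℤ) ^ (j : ℕ) • cechIns (R := R) R' (m + 1) j
      (∑ i : Fin (m + 2), (-1 : ℤ) ^ (i : ℕ) • cechIns (R := R) R' m i y) = 0 :=
  hw_dd (m + 1) (fun i => (cechIns (R := R) R' m i).toRingHom.toAddMonoidHom)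
    (fun i => (cechIns (R := R) R' (m + 1) i).toRingHom.toAddMonoidHom) (hw_pair' R R' m) y

lemma hw_cech_dd_witt (p : ℕ) [Fact p.Prime] (R R' : Type u) [CommRing R] [CommRing R']
    [Algebra R R'] (m : ℕ) (y : WittVector p (cechAlg (R := R) R' m).carrier) :
    ∑ j : Fin (m + 1 + 2), (-1 : ℤ) ^ (j : ℕ) •
      WittVector.map (cechIns (R := R) R' (m + 1) j :
        (cechAlg (R := R) R' (m + 1)).carrier →+* (cechAlg (R := R) R' (m + 1 + 1)).carrier)
      (∑ i : Fin (m + 2), (-1 : ℤ) ^ (i : ℕ) •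
        WittVector.map (cechIns (R := R) R' m i :
          (cechAlg (R := R) R' m).carrier →+* (cechAlg (R := R) R' (m + 1)).carrier) y) = 0 := by
  refine hw_dd (m + 1)
    (fun i => (WittVector.map (p := p) (cechIns (R := R) R' m i :
      (cechAlg (R := R) R' m).carrier →+* (cechAlg (R := R) R' (m + 1)).carrier)).toAddMonoidHom)
    (fun i => (WittVector.map (p := p) (cechIns (R := R) R' (m + 1) i :
      (cechAlg (R := R) R' (m + 1)).carrier →+*
        (cechAlg (R := R) R' (m + 1 + 1)).carrier)).toAddMonoidHom)
    ?_ y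
  intro i j hij x
  ext k
  exact hw_pair' R R' m i j hij (x.coeff k)

lemma hw_cechWittD_apply (p : ℕ) [Fact p.Prime] (R R' : Type u) [CommRing R] [CommRing R']
    [Algebra R R'] (m : ℕ) (y : WittVector p (cechAlg (R := R) R' m).carrier) :
    cechWittD p R' m y = ∑ i : Fin (m + 2), (-1 : ℤ) ^ (i : ℕ) •
        WittVector.map (cechIns (R := R) R' m i :
          (cechAlg (R := R) R' m).carrier →+* (cechAlg (R := R) R' (m + 1)).carrier) y := by
  rw [cechWittD, AddMonoidHom.finsetSum_apply]
  rfl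

lemma hw_dd0 {X : Type*} [AddCommGroup X] (f : Fin (0 + 2) → X) (h : f 0 = f 1) :
    ∑ j : Fin (0 + 2), (-1 : ℤ) ^ (j : ℕ) • f j = 0 := by
  rw [Fin.sum_univ_two, h]
  simp

lemma hw_dd0_alg {R A B : Type*} [CommRing R] [CommRing A] [CommRing B] [Algebra R A] [Algebra R B]
    (f : Fin (0 + 2) → A →ₐ[R] B) (y : R) :
    ∑ j : Fin (0 + 2), (-1 : ℤ) ^ (j : ℕ) • f j (algebraMap R A y) = 0 := by
  apply hw_dd0 (fun j => f j (algebraMap R A y))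
  simp

lemma hw_dd0_witt (p : ℕ) [Fact p.Prime] {R A B : Type*} [CommRing R] [CommRing A] [CommRing B]
    [Algebra R A] [Algebra R B] (f : Fin (0 + 2) → A →ₐ[R] B) (y : WittVector p R) :
    ∑ j : Fin (0 + 2), (-1 : ℤ) ^ (j : ℕ) •
      WittVector.map (f j : A →+* B) (WittVector.map (algebraMap R A) y) = 0 := by
  apply hw_dd0 (fun j => WittVector.map (f j : A →+* B) (WittVector.map (algebraMap R A) y))
  ext k
  simp [WittVector.map_coeff]

end HwFinal

theorem hatWKerF_cech_acyclic_of_indEtale_semiperfect (p : ℕ) [Fact p.Prime]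
    (n : ℕ) (hn : 1 ≤ n)
    (R R' : Type u) [CommRing R] [CommRing R'] [Algebra R R'] [CharP R p]
    (hsp : Function.Surjective fun x : R => x ^ p)
    [Module.FaithfullyFlat R R'] (hie : IsIndEtale R R') :
    -- the maps of the complex preserve the subgroups `Ŵ(-)[Fⁿ]`
    (∀ x : WittVector p R, IsHatWKerF p n x →
        IsHatWKerF p n (WittVector.map (algebraMap R R') x)) ∧
    (∀ (m : ℕ) (x : WittVector p (cechAlg (R := R) R' m).carrier), IsHatWKerF p n x →
        IsHatWKerF p n (cechWittD p R' m x)) ∧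
    -- exactness at the augmentation term
    (∀ x : WittVector p R, IsHatWKerF p n x →
        WittVector.map (algebraMap R R') x = 0 → x = 0) ∧
    -- exactness at the degree 0 term
    (∀ x : WittVector p (cechAlg (R := R) R' 0).carrier, IsHatWKerF p n x →
        (cechWittD p R' 0 x = 0 ↔
          ∃ y : WittVector p R, IsHatWKerF p n y ∧
            WittVector.map (algebraMap R R') y = x)) ∧
    -- exactness at the higher terms
    (∀ (m : ℕ) (x : WittVector p (cechAlg (R := R) R' (m + 1)).carrier),
        IsHatWKerF p n x →
        (cechWittD p R' (m + 1) x = 0 ↔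
          ∃ y, IsHatWKerF p n y ∧ cechWittD p R' m y = x)) := by
  have hspn : ∀ x : R, ∃ y : R, y ^ p ^ n = x := by
    clear hn
    induction n with
    | zero => exact fun x => ⟨x, by simp⟩
    | succ n ih =>
      intro x
      obtain ⟨y, rfl⟩ := hsp x
      obtain ⟨z, rfl⟩ := ih y
      exact ⟨z, by simp only [← pow_mul, pow_succ]⟩
  have h0 : (p : R) = 0 := CharP.cast_eq_zero R p
  have haug : ∀ y : R, ∑ j : Fin (0 + 2), (-1 : ℤ) ^ (j : ℕ) • cechIns (R := R) R' 0 j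
      (algebraMap R (cechAlg (R := R) R' 0).carrier y) = 0 := by
    intro y
    exact hw_dd0_alg (cechIns (R := R) R' 0) y
  have haugW : ∀ y : WittVector p R, cechWittD p R' 0
      (WittVector.map (algebraMap R (cechAlg (R := R) R' 0).carrier) y) = 0 := by
    intro y
    rw [hw_cechWittD_apply]
    exact hw_dd0_witt p (cechIns (R := R) R' 0) y
  refine ⟨fun x hx => hw_isHat_map p n _ x hx, fun m x hx => ?_, fun x _ hx => ?_, fun x hx => ⟨?_, ?_⟩,
    fun m x hx => ⟨?_, ?_⟩⟩
  · rw [hw_cechWittD_apply]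
    exact hw_isHat_sum p n _ _ x hx
  · refine WittVector.map_injective _ (FaithfulSMul.algebraMap_injective R R') ?_
    rw [hx, map_zero]
  · intro hx0
    have := hw_final p n (R := R) (A := R) (B := (cechAlg (R := R) R' 0).carrier)
      (C := (cechAlg (R := R) R' 1).carrier) (ι := Fin 1) (κ := Fin 2)
      (fun _ => Algebra.ofId R _) (fun _ => 1) (cechIns (R := R) R' 0) (fun j => (-1) ^ (j : ℕ))
      h0 (hw_relPerf_cech p n R R' hspn hie 0)
      (fun J x hx => by
        obtain ⟨y, hy⟩ := hw_cech_Q0 R R' J x hx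
        exact ⟨y, by simpa [Algebra.ofId_apply] using hy⟩)
      (fun J y hy => by
        refine ⟨y, ?_, rfl⟩
        simp only [Finset.univ_unique, Finset.sum_singleton, one_smul, Algebra.ofId_apply] at hy
        have h1 : y ∈ (J.map (algebraMap R R')).comap (algebraMap R R') := hy
        rw [Ideal.comap_map_eq_self_of_faithfullyFlat] at h1
        simpa using h1)
      (fun y => by
        have := haugW y
        rw [hw_cechWittD_apply] at this
        simpa using this)
      x hx (by rw [← hw_cechWittD_apply]; exact hx0)
    obtain ⟨y, hy, hy'⟩ := this
    refine ⟨y, hy, ?_⟩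
    simp only [Finset.univ_unique, Finset.sum_singleton, one_smul] at hy'
    exact hy'
  · rintro ⟨y, _, rfl⟩
    exact haugW y
  · intro hx0
    have := hw_final p n (R := R) (A := (cechAlg (R := R) R' m).carrier)
      (B := (cechAlg (R := R) R' (m + 1)).carrier)
      (C := (cechAlg (R := R) R' (m + 1 + 1)).carrier) (ι := Fin (m + 2)) (κ := Fin (m + 1 + 2))
      (cechIns (R := R) R' m) (fun j => (-1) ^ (j : ℕ)) (cechIns (R := R) R' (m + 1))
      (fun j => (-1) ^ (j : ℕ))
      h0 (hw_relPerf_cech p n R R' hspn hie (m + 1))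
      (hw_cech_Q R R' m)
      (fun J y hy => by
        cases m with
        | zero =>
          obtain ⟨u, hu⟩ := hw_cech_Q0 R R' J y hy
          refine ⟨_, hu, ?_⟩
          simp only [map_sub, smul_sub, Finset.sum_sub_distrib]
          rw [haug, sub_zero]
        | succ m =>
          obtain ⟨u, hu⟩ := hw_cech_Q R R' m J y hy
          refine ⟨_, hu, ?_⟩
          have := hw_cech_dd R R' m u
          simp only [map_sub _ y, smul_sub, Finset.sum_sub_distrib]
          rw [this, sub_zero])
      (hw_cech_dd_witt p R R' m)
      x hx (by rw [← hw_cechWittD_apply]; exact hx0)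
    obtain ⟨y, hy, hy'⟩ := this
    refine ⟨y, hy, ?_⟩
    rw [hw_cechWittD_apply]
    exact hy'
  · rintro ⟨y, _, rfl⟩
    rw [hw_cechWittD_apply, hw_cechWittD_apply]
    exact hw_cech_dd_witt p R R' m y
end
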